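/- There exists a constant C_dec > 0 depending only on the potential V such that for every ε with 0 < ε ≤ 1 and every solution u_ε of the vectorial Allen–Cahn system on the unit disk D², one has E_ε(u_ε, D²(9/16)) ≤ C_dec·[ (E_ε(u_ε, D²))^{3/2} + ε·E_ε(u_ε, D²) ]. -/

import Mathlib

open MeasureTheory Metric Filter Topology Bornology
open scoped RealInnerProductSpace ENNReal Topology

noncomputable section

/-- The euclidean plane. -/
abbrev E2 : Type := EuclideanSpace ℝ (Fin 2)

/-- The euclidean space `ℝ^k`. -/
abbrev Evec (k : ℕ) : Type := EuclideanSpace ℝ (Fin k)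

/-- The `i`-th standard basis vector of the plane. -/
def b2 (i : Fin 2) : E2 := EuclideanSpace.single i (1 : ℝ)

/-- The partial derivative of `u` in the `i`-th coordinate direction. -/
def pder {k : ℕ} (u : E2 → Evec k) (i : Fin 2) (x : E2) : Evec k :=
  fderiv ℝ u x (b2 i)

/-- The Laplacian of a map defined on the plane. -/
def lap {k : ℕ} (u : E2 → Evec k) (x : E2) : Evec k :=
  ∑ i : Fin 2, fderiv ℝ (pder u i) x (b2 i)

/-- `u` is a smooth solution of the vectorial Allen-Cahn system
`Δu = ε⁻² ∇V(u)` on the open set `U`. -/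
def IsSolution {k : ℕ} (V : Evec k → ℝ) (ε : ℝ) (U : Set E2) (u : E2 → Evec k) : Prop :=
  ContDiffOn ℝ (⊤ : ℕ∞) u U ∧ ∀ x ∈ U, lap u x = (ε ^ 2)⁻¹ • gradient V (u x)

/-- The squared modulus `|∇u|²` of the full gradient. -/
def gradSq {k : ℕ} (u : E2 → Evec k) (x : E2) : ℝ :=
  ∑ i : Fin 2, ‖pder u i x‖ ^ 2

/-- The energy density `e_ε(u) = (ε/2)|∇u|² + ε⁻¹ V(u)`. -/
def eDens {k : ℕ} (V : Evec k → ℝ) (ε : ℝ) (u : E2 → Evec k) (x : E2) : ℝ :=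
  ε / 2 * gradSq u x + ε⁻¹ * V (u x)

/-- The energy `E_ε(u, G)`. -/
def energy {k : ℕ} (V : Evec k → ℝ) (ε : ℝ) (u : E2 → Evec k) (G : Set E2) : ℝ :=
  ∫ x in G, eDens V ε u x

/-- The hypotheses (H₁), (H₂), (H₃) on the multi-well potential `V`:
smooth, nonnegative with `inf V = 0`, finitely many zeros (at least two),
positive definite Hessian at each zero, quadratic growth of `y·∇V(y)` at
infinity and coercivity. -/
structure IsMultiWell {k : ℕ} (V : Evec k → ℝ) : Prop where
  smooth : ContDiff ℝ (⊤ : ℕ∞) V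
  nonneg : ∀ y, 0 ≤ V y
  finite_zeros : {y : Evec k | V y = 0}.Finite
  two_le_card : 2 ≤ {y : Evec k | V y = 0}.ncard
  hess_posdef : ∀ σ : Evec k, V σ = 0 → ∀ w : Evec k, w ≠ 0 →
    0 < iteratedFDeriv ℝ 2 V σ ![w, w]
  growth : ∃ α > (0 : ℝ), ∃ R > (0 : ℝ), ∀ y : Evec k, R < ‖y‖ →
    α * ‖y‖ ^ 2 ≤ ⟪y, gradient V y⟫
  coercive : ∀ C : ℝ, ∃ R : ℝ, ∀ y : Evec k, R ≤ ‖y‖ → C ≤ V y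

/-! ### Partial derivatives in the plane -/

section PartialDerivatives

lemma two_le_infty : (2 : WithTop ℕ∞) ≤ ((⊤ : ℕ∞) : WithTop ℕ∞) :=
  WithTop.coe_le_coe.2 (le_top : (2 : ℕ∞) ≤ ⊤)

variable {F G : Type*} [NormedAddCommGroup F] [NormedSpace ℝ F]
  [NormedAddCommGroup G] [NormedSpace ℝ G]

/-- The `i`-th partial derivative of a map on the plane with values in any normed space. -/
def pd (i : Fin 2) (f : E2 → F) (x : E2) : F := fderiv ℝ f x (b2 i)

lemma contDiff_pd {f : E2 → F} (hf : ContDiff ℝ (⊤ : ℕ∞) f) (i : Fin 2) :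
    ContDiff ℝ (⊤ : ℕ∞) (pd i f) :=
  (hf.fderiv_right (m := (⊤ : ℕ∞)) (by exact_mod_cast le_refl _)).clm_apply contDiff_const

lemma continuous_pd {f : E2 → F} (hf : ContDiff ℝ 1 f) (i : Fin 2) : Continuous (pd i f) :=
  (hf.continuous_fderiv (by simp)).clm_apply continuous_const

lemma hasDerivAt_line {f : E2 → F} {x : E2} (i : Fin 2) (t : ℝ)
    (hf : DifferentiableAt ℝ f (x + t • b2 i)) :
    HasDerivAt (fun s : ℝ => f (x + s • b2 i)) (pd i f (x + t • b2 i)) t := by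
  have h1 : HasDerivAt (fun s : ℝ => x + s • b2 i) (b2 i) t := by
    simpa using ((hasDerivAt_id t).smul_const (b2 i)).const_add x
  exact hf.hasFDerivAt.comp_hasDerivAt t h1

lemma pd_add {f g : E2 → F} {x : E2} (i : Fin 2) (hf : DifferentiableAt ℝ f x)
    (hg : DifferentiableAt ℝ g x) : pd i (fun y => f y + g y) x = pd i f x + pd i g x := by
  simp [pd, fderiv_fun_add hf hg]

lemma pd_sub {f g : E2 → F} {x : E2} (i : Fin 2) (hf : DifferentiableAt ℝ f x)
    (hg : DifferentiableAt ℝ g x) : pd i (fun y => f y - g y) x = pd i f x - pd i g x := by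
  simp [pd, fderiv_fun_sub hf hg]

lemma pd_mul {f g : E2 → ℝ} {x : E2} (i : Fin 2) (hf : DifferentiableAt ℝ f x)
    (hg : DifferentiableAt ℝ g x) :
    pd i (fun y => f y * g y) x = pd i f x * g x + f x * pd i g x := by
  simp [pd, fderiv_fun_mul hf hg]; ring

lemma pd_const_mul {f : E2 → ℝ} {x : E2} (i : Fin 2) (c : ℝ) (hf : DifferentiableAt ℝ f x) :
    pd i (fun y => c * f y) x = c * pd i f x := by
  simp [pd, fderiv_const_mul hf]

lemma pd_inner {H : Type*} [NormedAddCommGroup H] [InnerProductSpace ℝ H] {f g : E2 → H} {x : E2}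
    (i : Fin 2) (hf : DifferentiableAt ℝ f x) (hg : DifferentiableAt ℝ g x) :
    pd i (fun y => ⟪f y, g y⟫) x = ⟪pd i f x, g x⟫ + ⟪f x, pd i g x⟫ := by
  simp only [pd, fderiv_inner_apply ℝ hf hg]
  ring

lemma pd_comp {f : E2 → F} {g : F → G} {x : E2} (i : Fin 2) (hg : DifferentiableAt ℝ g (f x))
    (hf : DifferentiableAt ℝ f x) :
    pd i (fun y => g (f y)) x = fderiv ℝ g (f x) (pd i f x) := by
  have := fderiv_comp x hg hf
  simp only [Function.comp_def] at this
  simp [pd, this]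

lemma pd_comp_deriv {f : E2 → ℝ} {g : ℝ → ℝ} {g' : ℝ} {x : E2} (i : Fin 2)
    (hg : HasDerivAt g g' (f x)) (hf : DifferentiableAt ℝ f x) :
    pd i (fun y => g (f y)) x = g' * pd i f x := by
  rw [pd_comp i hg.differentiableAt hf, hg.hasFDerivAt.fderiv]
  simp [mul_comm]

lemma pd_comm {f : E2 → F} (hf : ContDiff ℝ (⊤ : ℕ∞) f) (i j : Fin 2) (x : E2) :
    pd i (pd j f) x = pd j (pd i f) x := by
  have hs : IsSymmSndFDerivAt ℝ f x :=
    hf.contDiffAt.isSymmSndFDerivAt (by simpa using two_le_infty)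
  have hd : DifferentiableAt ℝ (fderiv ℝ f) x :=
    ((hf.fderiv_right (m := (⊤ : ℕ∞)) (by exact_mod_cast le_refl _)).differentiable
      (by simp)).differentiableAt
  have key : ∀ a b : Fin 2, pd a (pd b f) x = fderiv ℝ (fderiv ℝ f) x (b2 a) (b2 b) := by
    intro a b
    have : pd b f = fun y => fderiv ℝ f y (b2 b) := rfl
    rw [pd, this, fderiv_clm_apply hd (differentiableAt_const _)]
    simp
  rw [key, key]
  exact hs _ _

lemma pd_pd_comp {f : E2 → F} {g : F → G} (hg : ContDiff ℝ (⊤ : ℕ∞) g)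
    (hf : ContDiff ℝ (⊤ : ℕ∞) f) (i j : Fin 2) (x : E2) :
    pd i (pd j (fun y => g (f y))) x =
      fderiv ℝ (fderiv ℝ g) (f x) (pd i f x) (pd j f x) +
        fderiv ℝ g (f x) (pd i (pd j f) x) := by
  have hg1 : Differentiable ℝ g := hg.differentiable (by simp)
  have hf1 : Differentiable ℝ f := hf.differentiable (by simp)
  have h1 : pd j (fun y => g (f y)) = fun y => fderiv ℝ g (f y) (pd j f y) :=
    funext fun y => pd_comp j hg1.differentiableAt hf1.differentiableAt
  have hdg : Differentiable ℝ (fderiv ℝ g) :=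
    (hg.fderiv_right (m := (⊤ : ℕ∞)) (by exact_mod_cast le_refl _)).differentiable (by simp)
  have hpf : Differentiable ℝ (pd j f) := (contDiff_pd hf j).differentiable (by simp)
  rw [h1, pd, fderiv_clm_apply (c := fun y => fderiv ℝ g (f y))
    (hdg.comp hf1).differentiableAt hpf.differentiableAt]
  have := fderiv_comp x (hdg (f x)) (hf1 x)
  simp only [Function.comp_def] at this
  simp [this, pd]
  abel

/-- The integral of a partial derivative of a compactly supported function vanishes. -/
lemma integral_pd_eq_zero {f : E2 → ℝ} (hf : ContDiff ℝ 1 f) (hc : HasCompactSupport f)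
    (i : Fin 2) : ∫ x, pd i f x = 0 := by
  have h0 : HasCompactSupport (pd i f) := hc.fderiv_apply ℝ _
  have h := integral_mul_fderiv_eq_neg_fderiv_mul_of_integrable (𝕜 := ℝ)
    (μ := (volume : Measure E2)) (f := fun _ => (1 : ℝ)) (g := f) (v := b2 i) (by simp)
    (by
      simp only [one_mul]
      exact (continuous_pd hf i).integrable_of_hasCompactSupport h0)
    (by simpa using hf.continuous.integrable_of_hasCompactSupport hc)
    (fun x _ => differentiableAt_const _) (fun x _ => hf.differentiable (by simp) x)
  simpa [pd] using h

end PartialDerivatives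

/-! ### The maximum principle on rectangles -/

/-- The second derivative at a local maximum is nonpositive. -/
lemma deriv_deriv_nonpos_of_isLocalMax {h h' : ℝ → ℝ} {a t : ℝ}
    (h1 : ∀ᶠ s in 𝓝 t, HasDerivAt h (h' s) s) (h2 : HasDerivAt h' a t) (hm : IsLocalMax h t) :
    a ≤ 0 := by
  by_contra! ha
  have e1 : deriv h =ᶠ[𝓝 t] h' := h1.mono fun s hs => hs.deriv
  have hdd : deriv (deriv h) t = a := by rw [e1.deriv_eq]; exact h2.deriv
  have hmin : IsLocalMin h t :=
    isLocalMin_of_deriv_deriv_pos (by rw [hdd]; exact ha) hm.deriv_eq_zero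
      h1.self_of_nhds.continuousAt
  have hconst : ∀ᶠ s in 𝓝 t, h s = h t := by
    filter_upwards [hmin, hm] with s hs1 hs2 using le_antisymm hs2 hs1
  have e2 : h =ᶠ[𝓝 t] fun _ => h t := hconst
  have e3 : deriv h =ᶠ[𝓝 t] fun _ => 0 := by
    have := e2.deriv
    simpa using this
  rw [e3.deriv_eq] at hdd
  simp at hdd
  linarith

lemma pd_pd_nonpos_of_isLocalMax {g : E2 → ℝ} (hg : ContDiff ℝ (⊤ : ℕ∞) g) {x : E2}
    (hm : IsLocalMax g x) (i : Fin 2) : pd i (pd i g) x ≤ 0 := by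
  have h1 : ∀ s : ℝ, HasDerivAt (fun s : ℝ => g (x + s • b2 i)) (pd i g (x + s • b2 i)) s :=
    fun s => hasDerivAt_line i s (hg.differentiable (by simp) _)
  have h2 := hasDerivAt_line (x := x) i 0
    ((contDiff_pd hg i).differentiable (by simp) (x + (0 : ℝ) • b2 i))
  have hc : Tendsto (fun s : ℝ => x + s • b2 i) (𝓝 0) (𝓝 x) := by
    have : Continuous (fun s : ℝ => x + s • b2 i) := by fun_prop
    simpa using this.tendsto 0
  have hm' : IsLocalMax (fun s : ℝ => g (x + s • b2 i)) 0 := by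
    have := hc.eventually hm
    filter_upwards [this] with s hs
    simpa using hs
  simpa using deriv_deriv_nonpos_of_isLocalMax (Eventually.of_forall h1) h2 hm'

/-- Weak maximum principle: if the Laplacian of `g` is positive at the interior points of a
rectangle where `g > m`, and `g ≤ m` on the boundary, then `g ≤ m`. -/
lemma le_of_laplacian_pos {g : E2 → ℝ} (hg : ContDiff ℝ (⊤ : ℕ∞) g) {l r : Fin 2 → ℝ} {m : ℝ}
    (hb : ∀ x : E2, (∀ i, l i ≤ x i ∧ x i ≤ r i) → (∃ i, x i = l i ∨ x i = r i) → g x ≤ m)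
    (hl : ∀ x : E2, (∀ i, l i < x i ∧ x i < r i) → m < g x → 0 < ∑ i, pd i (pd i g) x)
    {x : E2} (hx : ∀ i, l i ≤ x i ∧ x i ≤ r i) : g x ≤ m := by
  set K : Set E2 := {x | ∀ i, l i ≤ x i ∧ x i ≤ r i} with hK
  have hKc : IsCompact K := by
    have : K = (WithLp.toLp 2) '' (Set.Icc l r) := by
      ext y
      simp only [hK, Set.mem_ofPred_eq, Set.mem_image, Set.mem_Icc, Pi.le_def]
      constructor
      · intro h
        exact ⟨fun i => y i, ⟨fun i => (h i).1, fun i => (h i).2⟩, rfl⟩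
      · rintro ⟨z, hz, rfl⟩ i
        exact ⟨hz.1 i, hz.2 i⟩
    rw [this]
    exact isCompact_Icc.image (PiLp.continuous_toLp 2 _)
  obtain ⟨z, hzK, hz⟩ := hKc.exists_isMaxOn ⟨x, hx⟩ hg.continuous.continuousOn
  refine (hz hx).trans ?_
  by_contra! hgz
  have hInt : ∀ i, l i < z i ∧ z i < r i := by
    intro i
    have h1 : z i ≠ l i := fun h => absurd (hb z hzK ⟨i, Or.inl h⟩) (not_le.2 hgz)
    have h2 : z i ≠ r i := fun h => absurd (hb z hzK ⟨i, Or.inr h⟩) (not_le.2 hgz)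
    exact ⟨lt_of_le_of_ne (hzK i).1 h1.symm, lt_of_le_of_ne (hzK i).2 h2⟩
  have hmem : K ∈ 𝓝 z := by
    have : ∀ i : Fin 2, ∀ᶠ y : E2 in 𝓝 z, l i ≤ y i ∧ y i ≤ r i := by
      intro i
      have hc : ContinuousAt (fun y : E2 => y i) z := by fun_prop
      filter_upwards [hc.eventually_const_le (hInt i).1 , hc.eventually_le_const (hInt i).2]
        with y h1 h2 using ⟨h1, h2⟩
    exact eventually_all.2 this
  have hloc : IsLocalMax g z := hz.isLocalMax hmem
  have := hl z hInt hgz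
  exact absurd this (not_lt.2 (Finset.sum_nonpos fun i _ => pd_pd_nonpos_of_isLocalMax hg hloc i))

/-! ### An interior gradient estimate -/

lemma b2_apply (i j : Fin 2) : b2 i j = if j = i then (1 : ℝ) else 0 := by
  simp [b2]

lemma pd_coord (i a : Fin 2) (x : E2) :
    pd a (fun y : E2 => y i) x = if i = a then (1 : ℝ) else 0 := by
  have h : HasFDerivAt (fun y : E2 => y i) (EuclideanSpace.proj i : E2 →L[ℝ] ℝ) x :=
    (EuclideanSpace.proj i : E2 →L[ℝ] ℝ).hasFDerivAt
  rw [pd, h.fderiv]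
  simp [b2_apply]

lemma differentiable_coord (i : Fin 2) : Differentiable ℝ (fun y : E2 => y i) :=
  (EuclideanSpace.proj i : E2 →L[ℝ] ℝ).differentiable

lemma pd_comp_coord {p : ℝ → ℝ} {p' : ℝ} {x : E2} {i : Fin 2} (a : Fin 2)
    (hp : HasDerivAt p p' (x i)) :
    pd a (fun y : E2 => p (y i)) x = if i = a then p' else 0 := by
  rw [pd_comp_deriv a hp (differentiable_coord i x), pd_coord]
  simp

lemma laplacian_comp_coord {p p' p'' : ℝ → ℝ} (hp : ∀ t, HasDerivAt p (p' t) t)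
    (hp' : ∀ t, HasDerivAt p' (p'' t) t) (i : Fin 2) (x : E2) :
    ∑ a, pd a (pd a (fun y : E2 => p (y i))) x = p'' (x i) := by
  have h : ∀ a, pd a (pd a (fun y : E2 => p (y i))) x = if i = a then p'' (x i) else 0 := by
    intro a
    have h1 : pd a (fun y : E2 => p (y i)) = fun y => if i = a then p' (y i) else 0 :=
      funext fun y => pd_comp_coord a (hp _)
    rw [h1]
    split_ifs with hia
    · rw [pd_comp_coord a (hp' _), if_pos hia]
    · simp [pd]
  simp [h]

lemma pd_comp_affine {g : E2 → ℝ} (hg : Differentiable ℝ g) (x₀ : E2) (L : E2 →L[ℝ] E2) {a : Fin 2}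
    {c : ℝ} (hL : L (b2 a) = c • b2 a) (y : E2) :
    pd a (fun y => g (x₀ + L y)) y = c * pd a g (x₀ + L y) := by
  have h1 : HasFDerivAt (fun y => x₀ + L y) L y := L.hasFDerivAt.const_add x₀
  have h2 := (hg (x₀ + L y)).hasFDerivAt.comp y h1
  have h3 : fderiv ℝ (fun y => g (x₀ + L y)) y = (fderiv ℝ g (x₀ + L y)).comp L := h2.fderiv
  simp [pd, h3, hL]

lemma pd_pd_comp_affine {g : E2 → ℝ} (hg : ContDiff ℝ (⊤ : ℕ∞) g) (x₀ : E2) (L : E2 →L[ℝ] E2)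
    {a : Fin 2} {c : ℝ} (hL : L (b2 a) = c • b2 a) (y : E2) :
    pd a (pd a (fun y => g (x₀ + L y))) y = c ^ 2 * pd a (pd a g) (x₀ + L y) := by
  have h1 : pd a (fun y => g (x₀ + L y)) = fun y => c * pd a g (x₀ + L y) :=
    funext fun y => pd_comp_affine (hg.differentiable (by simp)) x₀ L hL y
  have hd : Differentiable ℝ (pd a g) := (contDiff_pd hg a).differentiable (by simp)
  have hd2 : Differentiable ℝ (fun y => pd a g (x₀ + L y)) :=
    hd.comp ((differentiable_const x₀).add L.differentiable)
  rw [h1, pd_const_mul a c (hd2 y), pd_comp_affine hd x₀ L hL]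
  ring

lemma pd_half_sub_sub_add {A B P Q : E2 → ℝ} (hA : Differentiable ℝ A) (hB : Differentiable ℝ B)
    (hP : Differentiable ℝ P) (hQ : Differentiable ℝ Q) (a : Fin 2) :
    pd a (fun y => 1 / 2 * (A y - B y) - (P y + Q y)) =
      fun y => 1 / 2 * (pd a A y - pd a B y) - (pd a P y + pd a Q y) := by
  funext z
  have h := ((((hA z).hasFDerivAt.fun_sub (hB z).hasFDerivAt).const_mul (1 / 2 : ℝ)).fun_sub
    ((hP z).hasFDerivAt.fun_add (hQ z).hasFDerivAt)).fderiv
  rw [pd, h]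
  simp [pd]

/-- Interior gradient bound for Poisson's equation on a square, one-sided version. -/
lemma pd_le_of_laplacian_bound {g : E2 → ℝ} (hg : ContDiff ℝ (⊤ : ℕ∞) g) {x₀ : E2} {d M N : ℝ}
    (hd : 0 < d) (hM : ∀ x : E2, (∀ i, |x i - x₀ i| ≤ d) → |g x| ≤ M)
    (hN : ∀ x : E2, (∀ i, |x i - x₀ i| ≤ d) → |∑ i, pd i (pd i g) x| < N) (i : Fin 2) :
    pd i g x₀ ≤ 2 * M / d + d / 2 * N := by
  obtain ⟨j, hij, hcases, hsum⟩ : ∃ j : Fin 2, j ≠ i ∧ (∀ a, a = i ∨ a = j) ∧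
      ∀ f : Fin 2 → ℝ, ∑ a, f a = f i + f j := by
    fin_cases i
    · exact ⟨1, by decide, by decide, fun f => by simp⟩
    · exact ⟨0, by decide, by decide, fun f => by simp [add_comm]⟩
  have hM0 : 0 ≤ M := (abs_nonneg _).trans (hM x₀ (by simp [hd.le]))
  have hN0 : 0 < N := (abs_nonneg _).trans_lt (hN x₀ (by simp [hd.le]))
  set R : E2 →L[ℝ] E2 := ContinuousLinearMap.id ℝ E2 -
    (2 : ℝ) • (EuclideanSpace.proj i : E2 →L[ℝ] ℝ).smulRight (b2 i) with hR
  have hRi : ∀ y, (R y) i = - y i := by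
    intro y; simp [hR, b2_apply]; ring
  have hRj : ∀ y, (R y) j = y j := by
    intro y; simp [hR, b2_apply, hij]
  have hRb : ∀ a, R (b2 a) = (if a = i then (-1 : ℝ) else 1) • b2 a := by
    intro a
    rcases eq_or_ne a i with h | h
    · subst h; simp [hR, b2_apply]; module
    · simp [hR, b2_apply, h, h.symm]
  have hId : ∀ a, (ContinuousLinearMap.id ℝ E2) (b2 a) = (1 : ℝ) • b2 a := by simp
  set p : ℝ → ℝ := fun t => M / d ^ 2 * (t * (2 * d - t)) + N / 2 * (t * (d - t)) with hp
  set q : ℝ → ℝ := fun t => M / d ^ 2 * t ^ 2 with hq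
  have hp1 : ∀ t, HasDerivAt p (M / d ^ 2 * (2 * d - 2 * t) + N / 2 * (d - 2 * t)) t := by
    intro t
    have e1 : HasDerivAt (fun t : ℝ => t * (2 * d - t)) (1 * (2 * d - t) + t * (-1)) t :=
      (hasDerivAt_id t).mul ((hasDerivAt_id t).const_sub _)
    have e2 : HasDerivAt (fun t : ℝ => t * (d - t)) (1 * (d - t) + t * (-1)) t :=
      (hasDerivAt_id t).mul ((hasDerivAt_id t).const_sub _)
    exact ((e1.const_mul (M / d ^ 2)).add (e2.const_mul (N / 2))).congr_deriv (by ring)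
  have hp2 : ∀ t, HasDerivAt (fun t => M / d ^ 2 * (2 * d - 2 * t) + N / 2 * (d - 2 * t))
      (-(2 * M / d ^ 2) - N) t := by
    intro t
    have e : HasDerivAt (fun t : ℝ => 2 * t) (2 * 1) t := (hasDerivAt_id t).const_mul 2
    exact (((e.const_sub (2 * d)).const_mul (M / d ^ 2)).add
      ((e.const_sub d).const_mul (N / 2))).congr_deriv (by ring)
  have hq1 : ∀ t, HasDerivAt q (2 * M / d ^ 2 * t) t := by
    intro t
    exact (((hasDerivAt_id t).pow 2).const_mul (M / d ^ 2)).congr_deriv (by simp; ring)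
  have hq2 : ∀ t, HasDerivAt (fun t => 2 * M / d ^ 2 * t) (2 * M / d ^ 2) t := by
    intro t
    exact ((hasDerivAt_id t).const_mul (2 * M / d ^ 2)).congr_deriv (by simp)
  have hps : ContDiff ℝ (⊤ : ℕ∞) p := by fun_prop
  have hqs : ContDiff ℝ (⊤ : ℕ∞) q := by fun_prop
  set A : E2 → ℝ := fun y => g (x₀ + ContinuousLinearMap.id ℝ E2 y) with hA
  set B : E2 → ℝ := fun y => g (x₀ + R y) with hB
  have hAs : ContDiff ℝ (⊤ : ℕ∞) A :=
    hg.comp (contDiff_const.add (ContinuousLinearMap.id ℝ E2).contDiff)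
  have hBs : ContDiff ℝ (⊤ : ℕ∞) B := hg.comp (contDiff_const.add R.contDiff)
  set P : E2 → ℝ := fun y => p (y i) with hP
  set Q : E2 → ℝ := fun y => q (y j) with hQ
  have hPs : ContDiff ℝ (⊤ : ℕ∞) P :=
    hps.comp (EuclideanSpace.proj i : E2 →L[ℝ] ℝ).contDiff
  have hQs : ContDiff ℝ (⊤ : ℕ∞) Q :=
    hqs.comp (EuclideanSpace.proj j : E2 →L[ℝ] ℝ).contDiff
  have dif : ∀ {f : E2 → ℝ}, ContDiff ℝ (⊤ : ℕ∞) f → Differentiable ℝ f :=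
    fun h => h.differentiable (by simp)
  set φ : E2 → ℝ := fun y => 1 / 2 * (A y - B y) - (P y + Q y) with hφ
  have hφs : ContDiff ℝ (⊤ : ℕ∞) φ :=
    (contDiff_const.mul (hAs.sub hBs)).sub (hPs.add hQs)
  have hlap : ∀ y, ∑ a, pd a (pd a φ) y =
      1 / 2 * (∑ a, pd a (pd a g) (x₀ + y) - ∑ a, pd a (pd a g) (x₀ + R y)) + N := by
    intro y
    have h2 : ∀ a, pd a (pd a φ) y =
        1 / 2 * (pd a (pd a A) y - pd a (pd a B) y) - (pd a (pd a P) y + pd a (pd a Q) y) := by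
      intro a
      rw [hφ, pd_half_sub_sub_add (dif hAs) (dif hBs) (dif hPs) (dif hQs),
        pd_half_sub_sub_add (dif (contDiff_pd hAs a)) (dif (contDiff_pd hBs a))
          (dif (contDiff_pd hPs a)) (dif (contDiff_pd hQs a))]
    have h3 : ∀ a, pd a (pd a A) y = pd a (pd a g) (x₀ + y) := by
      intro a
      rw [hA, pd_pd_comp_affine hg x₀ _ (hId a)]; simp
    have h4 : ∀ a, pd a (pd a B) y = pd a (pd a g) (x₀ + R y) := by
      intro a
      rw [hB, pd_pd_comp_affine hg x₀ _ (hRb a)]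
      split_ifs <;> simp
    have h5 := laplacian_comp_coord hp1 hp2 i y
    have h6 := laplacian_comp_coord hq1 hq2 j y
    simp only [h2, h3, h4, Finset.sum_sub_distrib, ← Finset.mul_sum, Finset.sum_add_distrib]
    rw [hP, hQ, h5, h6]
    ring
  have hsq : ∀ y : E2, |y i| ≤ d → |y j| ≤ d → ∀ a, |(x₀ + y) a - x₀ a| ≤ d := by
    intro y h1 h2 a
    rcases hcases a with rfl | rfl <;> simpa
  have hsqR : ∀ y : E2, |y i| ≤ d → |y j| ≤ d → ∀ a, |(x₀ + R y) a - x₀ a| ≤ d := by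
    intro y h1 h2
    exact hsq _ (by rwa [hRi, abs_neg]) (by rwa [hRj])
  have hd2 : 0 < d ^ 2 := by positivity
  have main : ∀ y : E2, (∀ a, (if a = i then 0 else -d) ≤ y a ∧ y a ≤ d) → φ y ≤ 0 := by
    intro y hy
    refine le_of_laplacian_pos hφs (l := fun a => if a = i then 0 else -d) (r := fun _ => d)
      ?_ ?_ hy
    · intro z hz hzb
      have zi := hz i
      have zj := hz j
      simp only [if_true, if_neg hij] at zi zj
      have ai : |z i| ≤ d := abs_le.2 ⟨by linarith, zi.2⟩
      have aj : |z j| ≤ d := abs_le.2 ⟨by linarith, zj.2⟩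
      have gA := abs_le.1 (hM _ (hsq z ai aj))
      have gB := abs_le.1 (hM _ (hsqR z ai aj))
      have hψ : M / d ^ 2 * (z i * (2 * d - z i) + (z j) ^ 2) ≤ P z + Q z := by
        have : 0 ≤ N / 2 * (z i * (d - z i)) :=
          mul_nonneg (by linarith) (mul_nonneg zi.1 (by linarith))
        simp only [hP, hQ, hp, hq]
        linarith
      have hbig : d ^ 2 ≤ z i * (2 * d - z i) + (z j) ^ 2 → φ z ≤ 0 := by
        intro h
        have : M ≤ P z + Q z := by
          refine le_trans ?_ hψ
          calc M = M / d ^ 2 * d ^ 2 := by field_simp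
            _ ≤ _ := mul_le_mul_of_nonneg_left h (by positivity)
        simp only [hφ, hA, hB, ContinuousLinearMap.id_apply]
        linarith
      obtain ⟨a, ha⟩ := hzb
      rcases hcases a with rfl | rfl
      · simp only [if_true] at ha
        rcases ha with h0 | h0
        · have : R z = z := by simp [hR, h0]
          have h1 : 0 ≤ P z + Q z := by
            refine le_trans ?_ hψ
            rw [h0, zero_mul, zero_add]
            positivity
          simp only [hφ, hA, hB, ContinuousLinearMap.id_apply, this]
          linarith
        · apply hbig; rw [h0]; nlinarith [sq_nonneg (z j)]
      · simp only [if_neg hij] at ha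
        apply hbig
        have : (z a) ^ 2 = d ^ 2 := by rcases ha with h | h <;> rw [h]; ring
        rw [this]
        nlinarith [mul_nonneg zi.1 (by linarith : 0 ≤ 2 * d - z i)]
    · intro z hz _
      have zi := hz i
      have zj := hz j
      simp only [if_true, if_neg hij] at zi zj
      have ai : |z i| ≤ d := abs_le.2 ⟨by linarith, zi.2.le⟩
      have aj : |z j| ≤ d := abs_le.2 ⟨by linarith, zj.2.le⟩
      have gA := abs_lt.1 (hN _ (hsq z ai aj))
      have gB := abs_lt.1 (hN _ (hsqR z ai aj))
      rw [hlap]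
      linarith
  have hline : ∀ t : ℝ, 0 < t → t < d →
      (1 / 2 * (A (0 + t • b2 i) - B (0 + t • b2 i))) / t ≤ 2 * M / d + d / 2 * N := by
    intro t ht htd
    have hti : (0 + t • b2 i : E2) i = t := by simp [b2_apply]
    have htj : (0 + t • b2 i : E2) j = 0 := by simp [b2_apply, hij]
    have h := main (0 + t • b2 i) (by
      intro a
      rcases hcases a with rfl | rfl
      · rw [hti]; simp [ht.le, htd.le]
      · rw [htj, if_neg hij]; exact ⟨by linarith, hd.le⟩)
    have h' : 1 / 2 * (A (0 + t • b2 i) - B (0 + t • b2 i)) ≤ p t + q 0 := by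
      have : φ (0 + t • b2 i) = 1 / 2 * (A (0 + t • b2 i) - B (0 + t • b2 i)) - (p t + q 0) := by
        simp only [hφ, hP, hQ, hti, htj]
      linarith
    rw [div_le_iff₀ ht]
    refine h'.trans ?_
    simp only [hp, hq]
    have e1 : M / d ^ 2 * (t * (2 * d - t)) ≤ 2 * M / d * t := by
      have : 2 * M / d * t = M / d ^ 2 * (t * (2 * d)) := by field_simp
      rw [this]
      exact mul_le_mul_of_nonneg_left (by nlinarith) (by positivity)
    nlinarith [mul_pos ht ht]
  have hder : HasDerivAt (fun t : ℝ => 1 / 2 * (A (0 + t • b2 i) - B (0 + t • b2 i)))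
      (pd i g x₀) 0 := by
    have hA' := hasDerivAt_line (x := 0) i 0 (dif hAs (0 + (0 : ℝ) • b2 i))
    have hB' := hasDerivAt_line (x := 0) i 0 (dif hBs (0 + (0 : ℝ) • b2 i))
    refine ((hA'.sub hB').const_mul (1 / 2)).congr_deriv ?_
    rw [hA, hB, pd_comp_affine (dif hg) x₀ _ (hId i), pd_comp_affine (dif hg) x₀ _ (hRb i)]
    simp
    ring
  have hslope := hder.tendsto_slope_zero_right
  refine le_of_tendsto hslope ?_
  have hmem : Set.Ioo (0 : ℝ) d ∈ 𝓝[>] (0 : ℝ) := Ioo_mem_nhdsGT hd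
  filter_upwards [hmem] with t ht
  have h0 : A (0 + (0 : ℝ) • b2 i) - B (0 + (0 : ℝ) • b2 i) = 0 := by simp [hA, hB]
  have := hline t ht.1 ht.2
  rw [h0]
  simpa [div_eq_inv_mul] using this

/-- Interior gradient bound for Poisson's equation on a square. -/
lemma abs_pd_le_of_laplacian_bound {g : E2 → ℝ} (hg : ContDiff ℝ (⊤ : ℕ∞) g) {x₀ : E2}
    {d M N : ℝ} (hd : 0 < d) (hM : ∀ x : E2, (∀ i, |x i - x₀ i| ≤ d) → |g x| ≤ M)
    (hN : ∀ x : E2, (∀ i, |x i - x₀ i| ≤ d) → |∑ i, pd i (pd i g) x| < N) (i : Fin 2) :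
    |pd i g x₀| ≤ 2 * M / d + d / 2 * N := by
  have hneg : ∀ (f : E2 → ℝ) (a : Fin 2), pd a (fun y => - f y) = fun y => - pd a f y := by
    intro f a; funext y; simp [pd]
  refine abs_le'.2 ⟨pd_le_of_laplacian_bound hg hd hM hN i, ?_⟩
  have := pd_le_of_laplacian_bound hg.neg hd (x₀ := x₀) (M := M) (N := N)
    (fun x hx => by simpa using hM x hx)
    (fun x hx => by simpa only [hneg, Finset.sum_neg_distrib, abs_neg] using hN x hx) i
  simpa [hneg] using this

/-! ### Integration along coordinate lines -/

/-- The point of the plane with `i`-th coordinate `t` and other coordinate `s`. -/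
def planePoint (i : Fin 2) (t s : ℝ) : E2 := t • b2 i + s • b2 (1 - i)

lemma planePoint_apply_other (i : Fin 2) (t s : ℝ) : planePoint i t s (1 - i) = s := by
  fin_cases i <;> simp [planePoint, b2_apply]

lemma planePoint_coord (i : Fin 2) (x : E2) : planePoint i (x i) (x (1 - i)) = x := by
  ext a
  fin_cases i <;> fin_cases a <;> simp [planePoint, b2_apply]

lemma continuous_planePoint (i : Fin 2) :
    Continuous (fun p : ℝ × ℝ => planePoint i p.1 p.2) := by
  unfold planePoint; fun_prop

lemma measurePreserving_planePoint (i : Fin 2) :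
    MeasurePreserving (fun p : ℝ × ℝ => planePoint i p.1 p.2) volume volume := by
  have h0 : MeasurePreserving (fun p : ℝ × ℝ => (planePoint 0 p.1 p.2 : E2)) volume volume := by
    have h := (PiLp.volume_preserving_toLp (Fin 2)).comp (volume_preserving_finTwoArrow ℝ).symm
    have e : (fun p : ℝ × ℝ => (planePoint 0 p.1 p.2 : E2)) =
        WithLp.toLp 2 ∘ (MeasurableEquiv.finTwoArrow (α := ℝ)).symm := by
      funext p
      ext a
      fin_cases a <;> simp [planePoint, b2_apply]
    rw [e]
    exact h
  fin_cases i
  · exact h0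
  · have h := h0.comp (Measure.measurePreserving_swap (μ := (volume : Measure ℝ))
      (ν := (volume : Measure ℝ)))
    have e : (fun p : ℝ × ℝ => (planePoint 1 p.1 p.2 : E2)) =
        (fun p : ℝ × ℝ => planePoint 0 p.1 p.2) ∘ Prod.swap := by
      funext p
      ext a
      fin_cases a <;> simp [planePoint, b2_apply]
    change MeasurePreserving (fun p : ℝ × ℝ => (planePoint 1 p.1 p.2 : E2)) volume volume
    rw [e]
    exact h

lemma integrable_planePoint {φ : E2 → ℝ} (hφ : Continuous φ) (hi : Integrable φ) (i : Fin 2) :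
    Integrable (fun p : ℝ × ℝ => φ (planePoint i p.1 p.2)) (volume.prod volume) :=
  ((measurePreserving_planePoint i).integrable_comp hφ.aestronglyMeasurable).2 hi

lemma integral_integral_planePoint {φ : E2 → ℝ} (hφ : Continuous φ) (hi : Integrable φ)
    (i : Fin 2) : ∫ t, ∫ s, φ (planePoint i t s) = ∫ x, φ x := by
  rw [← integral_prod _ (integrable_planePoint hφ hi i)]
  have h := (measurePreserving_planePoint i).map_eq
  conv_rhs => rw [← h]
  rw [integral_map (measurePreserving_planePoint i).aemeasurable hφ.aestronglyMeasurable]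
  rfl

/-- The total variation of `w` along the line `{x i = t}`. -/
def lineVar (i : Fin 2) (w : E2 → ℝ) (t : ℝ) : ℝ := ∫ s, |pd (1 - i) w (planePoint i t s)|

section LineVar

variable {w : E2 → ℝ}

lemma lineVar_nonneg (i : Fin 2) (t : ℝ) : 0 ≤ lineVar i w t :=
  integral_nonneg fun _ => abs_nonneg _

lemma exists_bound_of_hasCompactSupport {φ : E2 → ℝ} (hc : HasCompactSupport φ) :
    ∃ r : ℝ, ∀ i t s, s ∉ Set.Icc (-r) r → φ (planePoint i t s) = 0 := by
  obtain ⟨r, hr⟩ := hc.isCompact.isBounded.subset_closedBall (0 : E2)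
  refine ⟨r, fun i t s hs => ?_⟩
  by_contra hne
  have h1 := hr (subset_tsupport _ hne)
  rw [mem_closedBall_zero_iff] at h1
  have h2 := (PiLp.norm_apply_le (planePoint i t s) (1 - i)).trans h1
  rw [planePoint_apply_other, Real.norm_eq_abs] at h2
  exact hs (abs_le.1 h2)

lemma continuous_lineVar (hw : ContDiff ℝ 1 w) (hc : HasCompactSupport w) (i : Fin 2) :
    Continuous (lineVar i w) := by
  have hc' : HasCompactSupport (pd (1 - i) w) := hc.fderiv_apply ℝ _
  obtain ⟨r, hr⟩ := exists_bound_of_hasCompactSupport hc'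
  have h : lineVar i w = fun t => ∫ s in Set.Icc (-r) r, |pd (1 - i) w (planePoint i t s)| := by
    funext t
    refine (setIntegral_eq_integral_of_forall_compl_eq_zero fun s hs => ?_).symm
    rw [hr i t s hs, abs_zero]
  rw [h]
  refine continuous_parametric_integral_of_continuous ?_ isCompact_Icc
  exact ((continuous_pd hw _).comp (continuous_planePoint i)).abs

lemma integrable_abs_pd (hw : ContDiff ℝ 1 w) (hc : HasCompactSupport w) (j : Fin 2) :
    Integrable (fun x => |pd j w x|) := by
  have hc' : HasCompactSupport (pd j w) := hc.fderiv_apply ℝ _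
  exact ((continuous_pd hw _).integrable_of_hasCompactSupport hc').abs

lemma integrable_lineVar (hw : ContDiff ℝ 1 w) (hc : HasCompactSupport w) (i : Fin 2) :
    Integrable (lineVar i w) :=
  (integrable_planePoint (continuous_pd hw _).abs (integrable_abs_pd hw hc (1 - i))
    i).integral_prod_left

lemma integral_lineVar (hw : ContDiff ℝ 1 w) (hc : HasCompactSupport w) (i : Fin 2) :
    ∫ t, lineVar i w t = ∫ x, |pd (1 - i) w x| :=
  integral_integral_planePoint (continuous_pd hw _).abs (integrable_abs_pd hw hc (1 - i)) i

lemma abs_le_lineVar (hw : ContDiff ℝ 1 w) (hc : HasCompactSupport w) (i : Fin 2) (x : E2) :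
    |w x| ≤ lineVar i w (x i) := by
  obtain ⟨r, hr⟩ := exists_bound_of_hasCompactSupport hc
  set t := x i with ht
  set h : ℝ → ℝ := fun s => w (planePoint i t s) with hh
  have hcs : HasCompactSupport h :=
    HasCompactSupport.intro isCompact_Icc fun s hs => hr i t s hs
  have hder : ∀ s, HasDerivAt h (pd (1 - i) w (planePoint i t s)) s := fun s =>
    hasDerivAt_line (1 - i) s (hw.differentiable (by simp) _)
  have hsm : ContDiff ℝ 1 h := by
    refine hw.comp ?_
    unfold planePoint
    fun_prop
  have hInt := hcs.integral_Iic_deriv_eq hsm (x (1 - i))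
  have hd : deriv h = fun s => pd (1 - i) w (planePoint i t s) := funext fun s => (hder s).deriv
  rw [hd] at hInt
  have hx : h (x (1 - i)) = w x := by rw [hh]; simp only [ht]; rw [planePoint_coord]
  rw [← hx, ← hInt]
  have hc' : HasCompactSupport (deriv h) := hcs.deriv
  have hi : Integrable (fun s => pd (1 - i) w (planePoint i t s)) := by
    rw [← hd]
    exact (hsm.continuous_deriv le_rfl).integrable_of_hasCompactSupport hc'
  calc |∫ s in Set.Iic (x (1 - i)), pd (1 - i) w (planePoint i t s)|
      ≤ ∫ s in Set.Iic (x (1 - i)), |pd (1 - i) w (planePoint i t s)| :=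
        abs_integral_le_integral_abs
    _ ≤ lineVar i w t := setIntegral_le_integral hi.abs
        (Eventually.of_forall fun _ => abs_nonneg _)

end LineVar

/-! ### Properties of the potential -/

section Potential

variable {k : ℕ} {V : Evec k → ℝ}

lemma norm_gradient (y : Evec k) : ‖gradient V y‖ = ‖fderiv ℝ V y‖ := by
  rw [gradient, LinearIsometryEquiv.norm_map]

lemma fderiv_eq_inner_gradient (y w : Evec k) : fderiv ℝ V y w = ⟪gradient V y, w⟫ := by
  rw [← toDual_gradient, InnerProductSpace.toDual_apply_apply]

lemma contDiff_fderiv {H : Type*} [NormedAddCommGroup H] [NormedSpace ℝ H] {f : Evec k → H}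
    (hf : ContDiff ℝ (⊤ : ℕ∞) f) : ContDiff ℝ (⊤ : ℕ∞) (fderiv ℝ f) :=
  hf.fderiv_right (m := (⊤ : ℕ∞)) (by exact_mod_cast le_refl _)

lemma continuous_norm_hessian_sub (hV : ContDiff ℝ (⊤ : ℕ∞) V)
    (A : Evec k →L[ℝ] Evec k →L[ℝ] ℝ) :
    Continuous fun y => ‖fderiv ℝ (fderiv ℝ V) y - A‖ := by
  have h1 : ContDiff ℝ (⊤ : ℕ∞) (fun y => fderiv ℝ (fderiv ℝ V) y - A) :=
    (contDiff_fderiv (contDiff_fderiv hV)).sub contDiff_const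
  exact (continuous_norm (E := Evec k →L[ℝ] Evec k →L[ℝ] ℝ)).comp h1.continuous

/-- A nonnegative smooth function controls the square of its gradient on bounded sets. -/
lemma exists_sq_norm_fderiv_le (hV : ContDiff ℝ (⊤ : ℕ∞) V) (h0 : ∀ y, 0 ≤ V y) (M : ℝ) :
    ∃ C > 0, ∀ y, ‖y‖ ≤ M → ‖fderiv ℝ V y‖ ^ 2 ≤ C * V y := by
  have hcomp : IsCompact (closedBall (0 : Evec k) (M + 1)) := isCompact_closedBall _ _
  obtain ⟨K₁, hK₁⟩ := hcomp.bddAbove_image (continuous_norm_hessian_sub hV 0).continuousOn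
  replace hK₁ : ∀ z ∈ closedBall (0 : Evec k) (M + 1), ‖fderiv ℝ (fderiv ℝ V) z‖ ≤ K₁ :=
    fun z hz => hK₁ ⟨z, hz, by simp⟩
  obtain ⟨K₂, hK₂⟩ := hcomp.bddAbove_image (contDiff_fderiv hV).continuous.norm.continuousOn
  replace hK₂ : ∀ z ∈ closedBall (0 : Evec k) (M + 1), ‖fderiv ℝ V z‖ ≤ K₂ :=
    fun z hz => hK₂ ⟨z, hz, rfl⟩
  set K := max (max K₁ K₂) 1 with hK
  have hK1 : 1 ≤ K := le_max_right _ _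
  refine ⟨4 * K, by linarith, fun y hy => ?_⟩
  have hgK : ‖gradient V y‖ ≤ K := by
    rw [norm_gradient]
    exact (hK₂ y (by simpa using hy.trans (by linarith))).trans
      ((le_max_right _ _).trans (le_max_left _ _))
  set h : Evec k := -(1 / (2 * K)) • gradient V y with hh
  have hnorm : ‖h‖ = 1 / (2 * K) * ‖gradient V y‖ := by
    rw [hh, norm_smul, norm_neg, Real.norm_of_nonneg (by positivity)]
  have hn1 : ‖h‖ ≤ 1 := by
    rw [hnorm, div_mul_eq_mul_div, div_le_one (by linarith)]
    linarith
  have hsub : closedBall y ‖h‖ ⊆ closedBall 0 (M + 1) := by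
    intro z hz
    rw [mem_closedBall, dist_eq_norm] at hz
    rw [mem_closedBall_zero_iff]
    calc ‖z‖ = ‖(z - y) + y‖ := by simp
      _ ≤ ‖z - y‖ + ‖y‖ := norm_add_le _ _
      _ ≤ M + 1 := by linarith
  have hyb : y ∈ closedBall y ‖h‖ := mem_closedBall_self (norm_nonneg _)
  have hlip : ∀ z ∈ closedBall y ‖h‖, ‖fderiv ℝ V z - fderiv ℝ V y‖ ≤ K * ‖h‖ := by
    intro z hz
    have := (convex_closedBall y ‖h‖).norm_image_sub_le_of_norm_fderiv_le (𝕜 := ℝ)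
      (f := fderiv ℝ V) (C := K)
      (fun x _ => (contDiff_fderiv hV).differentiable (by simp) x)
      (fun x hx => (hK₁ x (hsub hx)).trans ((le_max_left _ _).trans (le_max_left _ _))) hyb hz
    refine this.trans (mul_le_mul_of_nonneg_left ?_ (by linarith))
    rwa [mem_closedBall, dist_eq_norm] at hz
  have hT := (convex_closedBall y ‖h‖).norm_image_sub_le_of_norm_fderiv_le' (𝕜 := ℝ)
      (f := V) (φ := fderiv ℝ V y) (fun x _ => hV.differentiable (by simp) x) hlip hyb
      (y := y + h) (by simp [mem_closedBall, dist_eq_norm])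
  rw [add_sub_cancel_left, Real.norm_eq_abs] at hT
  have hT' := (abs_le.1 hT).2
  have hDh : fderiv ℝ V y h = -(1 / (2 * K)) * ‖gradient V y‖ ^ 2 := by
    rw [fderiv_eq_inner_gradient, hh, inner_smul_right, real_inner_self_eq_norm_sq]
  have hpos := h0 (y + h)
  rw [hDh, hnorm] at hT'
  rw [← norm_gradient]
  have e1 : K * (1 / (2 * K) * ‖gradient V y‖) * (1 / (2 * K) * ‖gradient V y‖) =
      ‖gradient V y‖ ^ 2 / (4 * K) := by field_simp; ring
  have e2 : 1 / (2 * K) * ‖gradient V y‖ ^ 2 = 2 * (‖gradient V y‖ ^ 2 / (4 * K)) := by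
    field_simp; ring
  rw [e1] at hT'
  have : ‖gradient V y‖ ^ 2 / (4 * K) ≤ V y := by linarith
  rwa [div_le_iff₀ (by linarith), mul_comm] at this

lemma hasDerivAt_fderiv_line (hV : Differentiable ℝ (fderiv ℝ V)) (σ v : Evec k) (t : ℝ) :
    HasDerivAt (fun t : ℝ => fderiv ℝ V (σ + t • v) v)
      (fderiv ℝ (fderiv ℝ V) (σ + t • v) v v) t := by
  have hline : HasDerivAt (fun t : ℝ => σ + t • v) v t := by
    simpa using ((hasDerivAt_id t).smul_const v).const_add σ
  have h := ((ContinuousLinearMap.apply ℝ ℝ v).hasFDerivAt.comp _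
    (hV (σ + t • v)).hasFDerivAt).comp_hasDerivAt t hline
  exact h

/-- Near a nondegenerate zero of `V`, the Hessian is bounded below and a Łojasiewicz inequality
holds. -/
lemma eventually_nondegenerate (hV : IsMultiWell V) {σ : Evec k} (hσ : V σ = 0) :
    ∃ l > 0, ∀ᶠ y in 𝓝 σ, (∀ w, l * ‖w‖ ^ 2 ≤ fderiv ℝ (fderiv ℝ V) y w w) ∧
      l * V y ≤ ‖fderiv ℝ V y‖ ^ 2 := by
  have hVd : Differentiable ℝ V := hV.smooth.differentiable (by simp)
  have hDd : Differentiable ℝ (fderiv ℝ V) := (contDiff_fderiv hV.smooth).differentiable (by simp)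
  have hpos : ∀ w ∈ sphere (0 : Evec k) 1, 0 < fderiv ℝ (fderiv ℝ V) σ w w := by
    intro w hw
    have hw0 : w ≠ 0 := by rintro rfl; simp at hw
    have := hV.hess_posdef σ hσ w hw0
    rw [iteratedFDeriv_two_apply] at this
    simpa using this
  obtain ⟨m, hm0, hm⟩ := (isCompact_sphere (0 : Evec k) 1).exists_forall_le'
    (f := fun w => fderiv ℝ (fderiv ℝ V) σ w w) (by fun_prop) hpos
  have hm' : ∀ w, m * ‖w‖ ^ 2 ≤ fderiv ℝ (fderiv ℝ V) σ w w := by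
    intro w
    rcases eq_or_ne w 0 with rfl | hw
    · simp
    · have hn : ‖w‖ ≠ 0 := norm_ne_zero_iff.2 hw
      have h := hm (‖w‖⁻¹ • w) (by simp [norm_smul, hn])
      simp only [map_smul, smul_apply, smul_eq_mul] at h
      have e : fderiv ℝ (fderiv ℝ V) σ w w =
          ‖w‖ ^ 2 * (‖w‖⁻¹ * (‖w‖⁻¹ * fderiv ℝ (fderiv ℝ V) σ w w)) := by field_simp
      rw [e, mul_comm]
      exact mul_le_mul_of_nonneg_left h (by positivity)
  have hD0 : fderiv ℝ V σ = 0 := by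
    have : IsLocalMin V σ := Eventually.of_forall fun y => by rw [hσ]; exact hV.nonneg y
    exact this.fderiv_eq_zero
  have hcont : Continuous fun y => ‖fderiv ℝ (fderiv ℝ V) y - fderiv ℝ (fderiv ℝ V) σ‖ :=
    continuous_norm_hessian_sub hV.smooth _
  have hev : ∀ᶠ y in 𝓝 σ, ‖fderiv ℝ (fderiv ℝ V) y - fderiv ℝ (fderiv ℝ V) σ‖ < m / 2 :=
    hcont.continuousAt.eventually (gt_mem_nhds (by
      beta_reduce
      rw [sub_self]
      exact (norm_zero (E := Evec k →L[ℝ] Evec k →L[ℝ] ℝ)).trans_lt (half_pos hm0)))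
  obtain ⟨δ, hδ, hball⟩ := Metric.eventually_nhds_iff.1 hev
  have hHess : ∀ y ∈ ball σ δ, ∀ w, m / 2 * ‖w‖ ^ 2 ≤ fderiv ℝ (fderiv ℝ V) y w w := by
    intro y hy w
    have h1 := hball (mem_ball.1 hy)
    have h2 : |(fderiv ℝ (fderiv ℝ V) y - fderiv ℝ (fderiv ℝ V) σ) w w| ≤ m / 2 * ‖w‖ ^ 2 := by
      have := ContinuousLinearMap.le_opNorm₂
        (fderiv ℝ (fderiv ℝ V) y - fderiv ℝ (fderiv ℝ V) σ) w w
      rw [Real.norm_eq_abs] at this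
      refine this.trans ?_
      rw [mul_assoc, ← sq]
      exact mul_le_mul_of_nonneg_right h1.le (by positivity)
    have h3 := (abs_le.1 h2).1
    simp only [sub_apply] at h3
    linarith [hm' w]
  refine ⟨m / 2, by linarith, ?_⟩
  filter_upwards [ball_mem_nhds σ hδ] with y hy
  refine ⟨hHess y hy, ?_⟩
  set v := y - σ with hv
  have hseg : ∀ t ∈ Set.Icc (0 : ℝ) 1, σ + t • v ∈ ball σ δ := by
    intro t ht
    rw [mem_ball, dist_eq_norm, add_sub_cancel_left, norm_smul, Real.norm_of_nonneg ht.1]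
    rw [mem_ball, dist_eq_norm] at hy
    calc t * ‖v‖ ≤ 1 * ‖v‖ := mul_le_mul_of_nonneg_right ht.2 (norm_nonneg _)
      _ < δ := by rw [one_mul]; exact hy
  have hline : ∀ t : ℝ, HasDerivAt (fun t : ℝ => σ + t • v) v t := fun t => by
    simpa using ((hasDerivAt_id t).smul_const v).const_add σ
  set g : ℝ → ℝ := fun t => V (σ + t • v) with hg
  set f : ℝ → ℝ := fun t => fderiv ℝ V (σ + t • v) v with hf
  have hg' : ∀ t, HasDerivAt g (f t) t := fun t =>
    (hVd (σ + t • v)).hasFDerivAt.comp_hasDerivAt t (hline t)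
  have hf' : ∀ t, HasDerivAt f (fderiv ℝ (fderiv ℝ V) (σ + t • v) v v) t := fun t =>
    hasDerivAt_fderiv_line hDd σ v t
  have hslope : ∀ c d : ℝ, 0 ≤ c → c < d → d ≤ 1 → m / 2 * ‖v‖ ^ 2 * (d - c) ≤ f d - f c := by
    intro c d hc hcd hd
    obtain ⟨e, he, hee⟩ := exists_hasDerivAt_eq_slope f _ hcd
      (fun t _ => (hf' t).continuousAt.continuousWithinAt) (fun t _ => hf' t)
    have h1 := hHess (σ + e • v) (hseg e ⟨by linarith [he.1], by linarith [he.2]⟩) v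
    rw [hee, le_div_iff₀ (by linarith)] at h1
    exact h1
  have hf0 : f 0 = 0 := by simp [hf, hD0]
  have h1 : m / 2 * ‖v‖ ^ 2 ≤ f 1 := by
    have := hslope 0 1 le_rfl one_pos le_rfl
    linarith
  obtain ⟨c, hc, hcc⟩ := exists_hasDerivAt_eq_slope g f one_pos
      (fun t _ => (hg' t).continuousAt.continuousWithinAt) (fun t _ => hg' t)
  have hg1 : g 1 = V y := by simp [hg, hv]
  have hg0 : g 0 = 0 := by simp [hg, hσ]
  have h2 : V y ≤ f 1 := by
    have h3 := hslope c 1 hc.1.le hc.2 le_rfl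
    have h4 : 0 ≤ m / 2 * ‖v‖ ^ 2 * (1 - c) :=
      mul_nonneg (by positivity) (by linarith [hc.2])
    rw [hg1, hg0] at hcc
    linarith
  have hy1 : σ + (1 : ℝ) • v = y := by simp [hv]
  have h5 : f 1 ≤ ‖fderiv ℝ V y‖ * ‖v‖ := by
    have := (fderiv ℝ V y).le_opNorm v
    simp only [hf, hy1]
    exact (le_abs_self _).trans this
  have h6 : m / 2 * ‖v‖ ≤ ‖fderiv ℝ V y‖ := by
    rcases (norm_nonneg v).eq_or_lt with h | h
    · rw [← h]; simp
    · refine le_of_mul_le_mul_right ?_ h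
      linarith
  calc m / 2 * V y ≤ m / 2 * (‖fderiv ℝ V y‖ * ‖v‖) :=
        mul_le_mul_of_nonneg_left (h2.trans h5) (by linarith)
    _ = ‖fderiv ℝ V y‖ * (m / 2 * ‖v‖) := by ring
    _ ≤ ‖fderiv ℝ V y‖ * ‖fderiv ℝ V y‖ := mul_le_mul_of_nonneg_left h6 (norm_nonneg _)
    _ = _ := by ring

/-- Uniform nondegeneracy of `V` on a sublevel set around its zeros. -/
lemma exists_sublevel_nondegenerate (hV : IsMultiWell V) :
    ∃ V₀ > 0, ∃ l > 0, ∀ y, V y ≤ V₀ →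
      (∀ w, l * ‖w‖ ^ 2 ≤ fderiv ℝ (fderiv ℝ V) y w w) ∧ l * V y ≤ ‖fderiv ℝ V y‖ ^ 2 := by
  set Z := {y : Evec k | V y = 0} with hZ
  have hunif : ∃ l > 0, ∀ σ ∈ Z, ∀ᶠ y in 𝓝 σ,
      (∀ w, l * ‖w‖ ^ 2 ≤ fderiv ℝ (fderiv ℝ V) y w w) ∧ l * V y ≤ ‖fderiv ℝ V y‖ ^ 2 := by
    have hloc : ∀ σ ∈ Z, ∀ᶠ l in 𝓝[>] (0 : ℝ), ∀ᶠ y in 𝓝 σ,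
        (∀ w, l * ‖w‖ ^ 2 ≤ fderiv ℝ (fderiv ℝ V) y w w) ∧ l * V y ≤ ‖fderiv ℝ V y‖ ^ 2 := by
      intro σ hσ
      obtain ⟨l₀, hl₀, h⟩ := eventually_nondegenerate hV hσ
      filter_upwards [Ioo_mem_nhdsGT hl₀] with l hl
      filter_upwards [h] with y hy
      exact ⟨fun w => (mul_le_mul_of_nonneg_right hl.2.le (by positivity)).trans (hy.1 w),
        (mul_le_mul_of_nonneg_right hl.2.le (hV.nonneg y)).trans hy.2⟩
    have hall := (hV.finite_zeros.eventually_all).2 hloc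
    obtain ⟨l, hl, hl0⟩ := (hall.and self_mem_nhdsWithin).exists
    exact ⟨l, hl0, hl⟩
  obtain ⟨l, hl0, hl⟩ := hunif
  set U := interior {y : Evec k | (∀ w, l * ‖w‖ ^ 2 ≤ fderiv ℝ (fderiv ℝ V) y w w) ∧
    l * V y ≤ ‖fderiv ℝ V y‖ ^ 2} with hU
  have hZU : Z ⊆ U := fun σ hσ => mem_interior_iff_mem_nhds.2 (hl σ hσ)
  obtain ⟨R, hR⟩ := hV.coercive 1
  have hcomp : IsCompact (closedBall (0 : Evec k) R \ U) :=
    (isCompact_closedBall _ _).diff isOpen_interior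
  obtain ⟨a, ha, hmin⟩ := hcomp.exists_forall_le' hV.smooth.continuous.continuousOn
    (a := 0) (fun y hy => lt_of_le_of_ne (hV.nonneg y) fun h => hy.2 (hZU h.symm))
  refine ⟨min (a / 2) (1 / 2), by positivity, l, hl0, fun y hy => ?_⟩
  have hyU : y ∈ U := by
    by_contra hyU
    have hyR : ‖y‖ < R := by
      by_contra! h
      have := hR y h
      have := hy.trans (min_le_right _ _)
      linarith
    have := hmin y ⟨mem_closedBall_zero_iff.2 hyR.le, hyU⟩
    have := hy.trans (min_le_left _ _)
    linarith
  have hmem := interior_subset hyU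
  exact hmem

end Potential

/-! ### Cutoff functions and testing of divergences -/

lemma pd_eq_zero_of_notMem_tsupport {χ : E2 → ℝ} {x : E2} (hx : x ∉ tsupport χ) (i : Fin 2) :
    pd i χ x = 0 := by
  rw [pd, fderiv_of_notMem_tsupport ℝ hx]
  simp

lemma exists_cutoff {a b : ℝ} (ha : 0 < a) (hab : a < b) :
    ∃ χ : E2 → ℝ, ContDiff ℝ (⊤ : ℕ∞) χ ∧ HasCompactSupport χ ∧ tsupport χ ⊆ ball 0 b ∧
      (∀ x ∈ closedBall (0 : E2) a, χ x = 1) ∧ (∀ x, 0 ≤ χ x) ∧ (∀ x, χ x ≤ 1) ∧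
      ∃ L > 0, ∀ i x, |pd i χ x| ≤ L := by
  set f : ContDiffBump (0 : E2) := ⟨a, (a + b) / 2, ha, by linarith⟩ with hf
  have hsm : ContDiff ℝ (⊤ : ℕ∞) f := f.contDiff
  have hd : ∀ i, ∃ L, ∀ x, ‖pd i f x‖ ≤ L := fun i =>
    (f.hasCompactSupport.fderiv_apply ℝ (b2 i)).exists_bound_of_continuous
      (continuous_pd (hsm.of_le (by simp)) i)
  choose L hL using hd
  refine ⟨f, hsm, f.hasCompactSupport, ?_, fun x hx => f.one_of_mem_closedBall hx,
    fun _ => f.nonneg, fun _ => f.le_one, |L 0| + |L 1| + 1, by positivity, fun i x => ?_⟩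
  · rw [f.tsupport_eq]
    exact closedBall_subset_ball (by simp only [hf]; linarith)
  · have h := hL i x
    rw [Real.norm_eq_abs] at h
    have h0 := le_abs_self (L 0)
    have h1 := le_abs_self (L 1)
    have h2 := abs_nonneg (L 0)
    have h3 := abs_nonneg (L 1)
    fin_cases i <;> simp only [Fin.zero_eta, Fin.mk_one] at h ⊢ <;> linarith

lemma abs_integral_le_of_abs_le {f e : E2 → ℝ} {s : Set E2} {C : ℝ} (hs : MeasurableSet s)
    (h0 : ∀ x ∉ s, f x = 0) (hb : ∀ x ∈ s, |f x| ≤ C * e x) (he : IntegrableOn e s) :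
    |∫ x, f x| ≤ C * ∫ x in s, e x := by
  rw [← setIntegral_eq_integral_of_forall_compl_eq_zero h0, ← integral_const_mul]
  exact norm_integral_le_of_norm_le (f := f) (he.const_mul C) ((ae_restrict_iff' hs).2
    (Eventually.of_forall fun x hx => hb x hx))

lemma abs_integral_mul_divergence_le {χ e : E2 → ℝ} {X : Fin 2 → E2 → ℝ} {b L C : ℝ}
    (hχ : ContDiff ℝ 1 χ) (hc : HasCompactSupport χ) (hs : tsupport χ ⊆ ball 0 b)
    (hL : ∀ i x, |pd i χ x| ≤ L) (hX : ∀ i, ContDiff ℝ 1 (X i))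
    (hb : ∀ i, ∀ x ∈ ball (0 : E2) b, |X i x| ≤ C * e x) (he : IntegrableOn e (ball 0 b)) :
    |∫ x, χ x * ∑ i, pd i (X i) x| ≤ 2 * L * C * ∫ x in ball 0 b, e x := by
  have hχd : Differentiable ℝ χ := hχ.differentiable (by simp)
  have hXd : ∀ i, Differentiable ℝ (X i) := fun i => (hX i).differentiable (by simp)
  have hint1 : ∀ i, Integrable fun x => χ x * pd i (X i) x := fun i =>
    (hχ.continuous.mul (continuous_pd (hX i) i)).integrable_of_hasCompactSupport hc.mul_right
  have hint2 : ∀ i, Integrable fun x => pd i χ x * X i x := fun i =>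
    ((continuous_pd hχ i).mul (hX i).continuous).integrable_of_hasCompactSupport
      (HasCompactSupport.mul_right (hc.fderiv_apply ℝ _))
  have hzero : ∀ i, ∫ x, χ x * pd i (X i) x = - ∫ x, pd i χ x * X i x := by
    intro i
    have h := integral_pd_eq_zero (hχ.mul (hX i)) hc.mul_right i
    have e1 : (fun x => pd i (fun y => χ y * X i y) x) =
        fun x => pd i χ x * X i x + χ x * pd i (X i) x :=
      funext fun x => pd_mul i (hχd x) (hXd i x)
    rw [e1, integral_add (hint2 i) (hint1 i)] at h
    linarith
  have hbd : ∀ i, |∫ x, pd i χ x * X i x| ≤ L * C * ∫ x in ball 0 b, e x := by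
    intro i
    refine abs_integral_le_of_abs_le measurableSet_ball (fun x hx => ?_) (fun x hx => ?_) he
    · rw [pd_eq_zero_of_notMem_tsupport (fun h => hx (hs h)), zero_mul]
    · rw [abs_mul, mul_assoc]
      exact mul_le_mul (hL i x) (hb i x hx) (abs_nonneg _) ((abs_nonneg _).trans (hL i x))
  have hsum : ∫ x, χ x * ∑ i, pd i (X i) x =
      - (∫ x, pd 0 χ x * X 0 x) - ∫ x, pd 1 χ x * X 1 x := by
    simp only [Fin.sum_univ_two, mul_add]
    rw [integral_add (hint1 0) (hint1 1), hzero, hzero]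
    ring
  rw [hsum]
  have h0 := hbd 0
  have h1 := hbd 1
  rw [abs_le] at *
  constructor <;> linarith [h0.1, h0.2, h1.1, h1.2]

/-! ### Energy density and stress tensor -/

section Energy

variable {k : ℕ} {V : Evec k → ℝ} {ε : ℝ} {u : E2 → Evec k}

lemma eDens_eq (x : E2) :
    eDens V ε u x = ε / 2 * ∑ i, ‖pd i u x‖ ^ 2 + ε⁻¹ * V (u x) := rfl

lemma eDens_nonneg (h0 : ∀ y, 0 ≤ V y) (hε : 0 < ε) (x : E2) : 0 ≤ eDens V ε u x := by
  rw [eDens_eq]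
  have := h0 (u x)
  positivity

lemma mul_sq_norm_pd_le (h0 : ∀ y, 0 ≤ V y) (hε : 0 < ε) (i : Fin 2) (x : E2) :
    ε * ‖pd i u x‖ ^ 2 ≤ 2 * eDens V ε u x := by
  rw [eDens_eq]
  have h1 : 0 ≤ ε⁻¹ * V (u x) := mul_nonneg (by positivity) (h0 _)
  have h2 : ‖pd i u x‖ ^ 2 ≤ ∑ j, ‖pd j u x‖ ^ 2 :=
    Finset.single_le_sum (f := fun j => ‖pd j u x‖ ^ 2) (fun _ _ => sq_nonneg _) (Finset.mem_univ i)
  have h3 := mul_le_mul_of_nonneg_left h2 hε.le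
  linarith

lemma potential_le_eDens (hε : 0 < ε) (x : E2) : ε⁻¹ * V (u x) ≤ eDens V ε u x := by
  rw [eDens_eq]
  have : 0 ≤ ε / 2 * ∑ i, ‖pd i u x‖ ^ 2 := by positivity
  linarith

lemma potential_le_eDens_of_le_one (h0 : ∀ y, 0 ≤ V y) (hε : 0 < ε) (hε1 : ε ≤ 1) (x : E2) :
    V (u x) ≤ eDens V ε u x := by
  refine le_trans ?_ (potential_le_eDens hε x)
  exact le_mul_of_one_le_left (h0 _) ((one_le_inv₀ hε).2 hε1)

lemma contDiff_eDens (hV : ContDiff ℝ (⊤ : ℕ∞) V) (hu : ContDiff ℝ (⊤ : ℕ∞) u) :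
    ContDiff ℝ (⊤ : ℕ∞) (eDens V ε u) := by
  have h1 : ∀ i, ContDiff ℝ (⊤ : ℕ∞) fun x => ‖pd i u x‖ ^ 2 := fun i =>
    (contDiff_pd hu i).norm_sq ℝ
  have h2 : ContDiff ℝ (⊤ : ℕ∞) fun x => ∑ i, ‖pd i u x‖ ^ 2 := ContDiff.sum fun i _ => h1 i
  exact (contDiff_const.mul h2).add (contDiff_const.mul (hV.comp hu))

lemma abs_fderiv_apply_pd_le (h0 : ∀ y, 0 ≤ V y) (hε : 0 < ε) {W : Evec k → ℝ} {C₁ : ℝ}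
    (hC : 0 ≤ C₁) {x : E2} (h : ‖fderiv ℝ W (u x)‖ ^ 2 ≤ C₁ * V (u x)) (i : Fin 2) :
    |fderiv ℝ W (u x) (pd i u x)| ≤ (C₁ / 2 + 1) * eDens V ε u x := by
  have h1 := (fderiv ℝ W (u x)).le_opNorm (pd i u x)
  rw [Real.norm_eq_abs] at h1
  refine h1.trans ?_
  have h2 := mul_sq_norm_pd_le (u := u) h0 hε i x
  have h3 := mul_le_mul_of_nonneg_left (potential_le_eDens (V := V) (u := u) hε x) hC
  set a := ‖fderiv ℝ W (u x)‖
  set b := ‖pd i u x‖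
  have h4 : a * b ≤ (ε⁻¹ * a ^ 2 + ε * b ^ 2) / 2 := by
    have : (ε⁻¹ * a ^ 2 + ε * b ^ 2) / 2 - a * b = ε⁻¹ * (a - ε * b) ^ 2 / 2 := by
      field_simp; ring
    have h5 : 0 ≤ ε⁻¹ * (a - ε * b) ^ 2 / 2 := by positivity
    linarith
  have h5 : ε⁻¹ * a ^ 2 ≤ C₁ * (ε⁻¹ * V (u x)) := by
    have := mul_le_mul_of_nonneg_left h (inv_pos.2 hε).le
    linarith
  linarith

lemma sum_sq_pd_potential_le (hV : Differentiable ℝ V) (hu : Differentiable ℝ u) {C₁ : ℝ} {x : E2}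
    (h : ‖fderiv ℝ V (u x)‖ ^ 2 ≤ C₁ * V (u x)) :
    ∑ i, pd i (fun y => V (u y)) x ^ 2 ≤ C₁ * V (u x) * ∑ i, ‖pd i u x‖ ^ 2 := by
  rw [Finset.mul_sum]
  refine Finset.sum_le_sum fun i _ => ?_
  rw [pd_comp i (hV _) (hu _)]
  have h1 := (fderiv ℝ V (u x)).le_opNorm (pd i u x)
  rw [Real.norm_eq_abs] at h1
  calc _ ≤ (‖fderiv ℝ V (u x)‖ * ‖pd i u x‖) ^ 2 := by
        rw [← sq_abs]; exact pow_le_pow_left₀ (abs_nonneg _) h1 2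
    _ = ‖fderiv ℝ V (u x)‖ ^ 2 * ‖pd i u x‖ ^ 2 := by ring
    _ ≤ _ := mul_le_mul_of_nonneg_right h (sq_nonneg _)

lemma laplacian_potential (hV : ContDiff ℝ (⊤ : ℕ∞) V) (hu : ContDiff ℝ (⊤ : ℕ∞) u) {x : E2}
    (hpde : ∑ i, pd i (pd i u) x = (ε ^ 2)⁻¹ • gradient V (u x)) :
    ∑ i, pd i (pd i (fun y => V (u y))) x =
      ∑ i, fderiv ℝ (fderiv ℝ V) (u x) (pd i u x) (pd i u x) +
        (ε ^ 2)⁻¹ * ‖fderiv ℝ V (u x)‖ ^ 2 := by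
  simp only [pd_pd_comp hV hu]
  rw [Finset.sum_add_distrib, ← map_sum, hpde, map_smul, fderiv_eq_inner_gradient,
    real_inner_self_eq_norm_sq, norm_gradient, smul_eq_mul]

/-- The stress-energy tensor of a map. -/
def stress (V : Evec k → ℝ) (ε : ℝ) (u : E2 → Evec k) (i j : Fin 2) (x : E2) : ℝ :=
  (if i = j then eDens V ε u x else 0) - ε * ⟪pd i u x, pd j u x⟫

lemma contDiff_stress (hV : ContDiff ℝ (⊤ : ℕ∞) V) (hu : ContDiff ℝ (⊤ : ℕ∞) u) (i j : Fin 2) :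
    ContDiff ℝ (⊤ : ℕ∞) (stress V ε u i j) := by
  have h1 : ContDiff ℝ (⊤ : ℕ∞) fun x => if i = j then eDens V ε u x else 0 := by
    split_ifs
    · exact contDiff_eDens hV hu
    · exact contDiff_const
  exact h1.sub (contDiff_const.mul ((contDiff_pd hu i).inner ℝ (contDiff_pd hu j)))

lemma abs_stress_le (h0 : ∀ y, 0 ≤ V y) (hε : 0 < ε) (i j : Fin 2) (x : E2) :
    |stress V ε u i j x| ≤ 3 * eDens V ε u x := by
  have he := eDens_nonneg (u := u) h0 hε x
  have h1 : |ε * ⟪pd i u x, pd j u x⟫| ≤ 2 * eDens V ε u x := by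
    rw [abs_mul, abs_of_pos hε]
    have h2 := abs_real_inner_le_norm (pd i u x) (pd j u x)
    have h3 : ‖pd i u x‖ * ‖pd j u x‖ ≤ (‖pd i u x‖ ^ 2 + ‖pd j u x‖ ^ 2) / 2 := by
      nlinarith [sq_nonneg (‖pd i u x‖ - ‖pd j u x‖)]
    have h4 := mul_le_mul_of_nonneg_left (h2.trans h3) hε.le
    have h5 := mul_sq_norm_pd_le (u := u) h0 hε i x
    have h6 := mul_sq_norm_pd_le (u := u) h0 hε j x
    linarith
  have h2 : |if i = j then eDens V ε u x else 0| ≤ eDens V ε u x := by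
    split_ifs
    · rw [abs_of_nonneg he]
    · simpa using he
  unfold stress
  exact (abs_sub _ _).trans (by linarith)

lemma sum_stress_diag (x : E2) : ∑ i, stress V ε u i i x = 2 * (ε⁻¹ * V (u x)) := by
  simp only [stress, if_true, eDens_eq, Fin.sum_univ_two, real_inner_self_eq_norm_sq]
  ring

lemma divergence_stress (hV : ContDiff ℝ (⊤ : ℕ∞) V) (hu : ContDiff ℝ (⊤ : ℕ∞) u) (hε : 0 < ε)
    {x : E2} (hpde : ∑ i, pd i (pd i u) x = (ε ^ 2)⁻¹ • gradient V (u x)) (i : Fin 2) :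
    ∑ j, pd j (stress V ε u i j) x = 0 := by
  have hud : Differentiable ℝ u := hu.differentiable (by simp)
  have hVd : Differentiable ℝ V := hV.differentiable (by simp)
  have hpd : ∀ j, Differentiable ℝ (pd j u) := fun j => (contDiff_pd hu j).differentiable (by simp)
  have hed : Differentiable ℝ (eDens V ε u) := (contDiff_eDens hV hu).differentiable (by simp)
  have hin : ∀ a b, Differentiable ℝ fun y => ⟪pd a u y, pd b u y⟫ := fun a b =>
    ((hpd a).inner ℝ (hpd b))
  have hVu : Differentiable ℝ fun y => V (u y) := hVd.comp hud
  have hinner : ∀ a b c, pd a (fun y => ⟪pd b u y, pd c u y⟫) x =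
      ⟪pd a (pd b u) x, pd c u x⟫ + ⟪pd b u x, pd a (pd c u) x⟫ := fun a b c =>
    pd_inner a (hpd b x) (hpd c x)
  have he : pd i (eDens V ε u) x =
      ε * ∑ j, ⟪pd i (pd j u) x, pd j u x⟫ + ε⁻¹ * fderiv ℝ V (u x) (pd i u x) := by
    have e1 : eDens V ε u = fun y => ε / 2 * (⟪pd 0 u y, pd 0 u y⟫ + ⟪pd 1 u y, pd 1 u y⟫) +
        ε⁻¹ * V (u y) := by
      funext y
      simp only [eDens_eq, Fin.sum_univ_two, real_inner_self_eq_norm_sq]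
    have hsum : Differentiable ℝ fun y => ⟪pd 0 u y, pd 0 u y⟫ + ⟪pd 1 u y, pd 1 u y⟫ :=
      (hin 0 0).add (hin 1 1)
    rw [e1, pd_add i (hsum.const_mul (ε / 2) x) (hVu.const_mul ε⁻¹ x),
      pd_const_mul i _ (hsum x), pd_const_mul i _ (hVu x),
      pd_add i (hin 0 0 x) (hin 1 1 x), hinner, hinner, pd_comp i (hVd _) (hud x),
      Fin.sum_univ_two, real_inner_comm (pd i (pd 0 u) x), real_inner_comm (pd i (pd 1 u) x)]
    ring
  have hs : ∀ j, pd j (stress V ε u i j) x = (if i = j then pd i (eDens V ε u) x else 0) -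
      ε * (⟪pd j (pd i u) x, pd j u x⟫ + ⟪pd i u x, pd j (pd j u) x⟫) := by
    intro j
    have e1 : stress V ε u i j = fun y => (if i = j then eDens V ε u y else 0) -
      ε * ⟪pd i u y, pd j u y⟫ := rfl
    have hd : Differentiable ℝ fun y => if i = j then eDens V ε u y else 0 := by
      split_ifs
      · exact hed
      · exact differentiable_const _
    rw [e1, pd_sub j (hd x) ((hin i j).const_mul ε x), pd_const_mul j _ (hin i j x), hinner]
    congr 1
    split_ifs with h
    · subst h; rfl
    · simp [pd]
  have hlap : ⟪pd i u x, ∑ j, pd j (pd j u) x⟫ = (ε ^ 2)⁻¹ * fderiv ℝ V (u x) (pd i u x) := by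
    rw [hpde, inner_smul_right, fderiv_eq_inner_gradient, real_inner_comm]
  rw [inner_sum] at hlap
  simp only [hs, Finset.sum_sub_distrib, Finset.sum_ite_eq, Finset.mem_univ, if_true, he,
    ← Finset.mul_sum, Finset.sum_add_distrib, hlap]
  have hc : ∀ j, pd j (pd i u) x = pd i (pd j u) x := fun j => pd_comm hu j i x
  simp only [hc]
  field_simp
  ring

end Energy

/-! ### Testing the stress tensor -/

section StressTest

variable {k : ℕ} {V : Evec k → ℝ} {ε : ℝ} {u : E2 → Evec k}

lemma contDiff_comp_coord {f : ℝ → ℝ} (hf : ContDiff ℝ 1 f) (i : Fin 2) :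
    ContDiff ℝ 1 fun x : E2 => f (x i) :=
  hf.comp (EuclideanSpace.proj i : E2 →L[ℝ] ℝ).contDiff

lemma hasDerivAt_integral_zero {F : ℝ → ℝ} (hF : Continuous F) (t : ℝ) :
    HasDerivAt (fun t => ∫ s in (0 : ℝ)..t, F s) (F t) t :=
  (hF.integral_hasStrictDerivAt 0 t).hasDerivAt

lemma contDiff_integral_zero {F : ℝ → ℝ} (hF : Continuous F) :
    ContDiff ℝ 1 fun t => ∫ s in (0 : ℝ)..t, F s := by
  refine contDiff_one_iff_deriv.2 ⟨fun t => (hasDerivAt_integral_zero hF t).differentiableAt, ?_⟩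
  rwa [funext fun t => (hasDerivAt_integral_zero hF t).deriv]

lemma abs_integral_stress_le (hV : ContDiff ℝ (⊤ : ℕ∞) V) (h0 : ∀ y, 0 ≤ V y)
    (hu : ContDiff ℝ (⊤ : ℕ∞) u) (hε : 0 < ε) {b : ℝ}
    (hpde : ∀ x ∈ ball (0 : E2) b, ∑ i, pd i (pd i u) x = (ε ^ 2)⁻¹ • gradient V (u x))
    (he : IntegrableOn (eDens V ε u) (ball 0 b)) {χ : E2 → ℝ} {L : ℝ} (hχ : ContDiff ℝ 1 χ)
    (hc : HasCompactSupport χ) (hs : tsupport χ ⊆ ball 0 b) (hL : ∀ i x, |pd i χ x| ≤ L)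
    {F : ℝ → ℝ} (hF : Continuous F) {B : ℝ} (hB : ∀ t, |∫ s in (0 : ℝ)..t, F s| ≤ B) (i : Fin 2) :
    |∫ x, χ x * (F (x i) * stress V ε u i i x)| ≤
      6 * L * B * ∫ x in ball (0 : E2) b, eDens V ε u x := by
  set f : ℝ → ℝ := fun t => ∫ s in (0 : ℝ)..t, F s with hf
  have hstr : ∀ j, ContDiff ℝ 1 (stress V ε u i j) := fun j =>
    (contDiff_stress hV hu i j).of_le (by simp)
  have hfc := contDiff_comp_coord (contDiff_integral_zero hF) i
  have h := abs_integral_mul_divergence_le (e := eDens V ε u)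
    (X := fun j x => f (x i) * stress V ε u i j x) (C := 3 * B) hχ hc hs hL
    (fun j => hfc.mul (hstr j)) (fun j x _ => ?_) he
  · have heq : ∀ x, χ x * ∑ j, pd j (fun x => f (x i) * stress V ε u i j x) x =
        χ x * (F (x i) * stress V ε u i i x) := by
      intro x
      by_cases hx : x ∈ ball (0 : E2) b
      · congr 1
        have h1 : ∀ j, pd j (fun x => f (x i) * stress V ε u i j x) x =
            (if i = j then F (x i) else 0) * stress V ε u i j x +
              f (x i) * pd j (stress V ε u i j) x := by
          intro j
          rw [pd_mul j (hfc.differentiable (by simp) x) ((hstr j).differentiable (by simp) x),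
            pd_comp_coord j (hasDerivAt_integral_zero hF (x i))]
        simp only [h1, Finset.sum_add_distrib, ← Finset.mul_sum,
          divergence_stress hV hu hε (hpde x hx) i, ite_mul, zero_mul, Finset.sum_ite_eq,
          Finset.mem_univ, if_true, mul_zero, add_zero]
      · have : χ x = 0 := by
          by_contra hne
          exact hx (hs (subset_tsupport _ hne))
        simp [this]
    rw [integral_congr_ae (Eventually.of_forall heq)] at h
    refine h.trans (le_of_eq ?_)
    ring
  · have h1 := abs_stress_le (u := u) h0 hε i j x
    have h2 := hB (x i)
    rw [abs_mul]
    calc _ ≤ B * (3 * eDens V ε u x) :=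
          mul_le_mul h2 h1 (abs_nonneg _) ((abs_nonneg _).trans h2)
      _ = _ := by ring

lemma abs_integral_le_of_le {F G : ℝ → ℝ} (hF : Continuous F) (hF0 : ∀ t, 0 ≤ F t)
    (hG : Integrable G) (hFG : ∀ t, F t ≤ G t) (t : ℝ) :
    |∫ s in (0 : ℝ)..t, F s| ≤ ∫ s, G s := by
  have hG0 : ∀ t, 0 ≤ G t := fun t => (hF0 t).trans (hFG t)
  have h1 : ‖∫ s in (0 : ℝ)..t, F s‖ ≤ ∫ s in Set.uIoc 0 t, ‖F s‖ :=
    intervalIntegral.norm_integral_le_integral_norm_uIoc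
  refine h1.trans ?_
  refine (integral_mono (μ := volume.restrict (Set.uIoc 0 t)) (g := G)
    ?_ hG.integrableOn fun s => ?_).trans
    (setIntegral_le_integral hG (Eventually.of_forall hG0))
  · exact (hF.norm.integrableOn_uIcc).mono_set Set.uIoc_subset_uIcc
  · simpa [abs_of_nonneg (hF0 s)] using hFG s

/-- Localised potentials have partial derivatives controlled in `L¹` by the energy. -/
lemma integral_abs_pd_cutoff_le (h0 : ∀ y, 0 ≤ V y)
    (hu : ContDiff ℝ (⊤ : ℕ∞) u) (hε : 0 < ε) {b : ℝ}
    (he : IntegrableOn (eDens V ε u) (ball 0 b)) {W : Evec k → ℝ} (hW : ContDiff ℝ (⊤ : ℕ∞) W)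
    (hW0 : ∀ y, 0 ≤ W y) {C₁ C₂ : ℝ} (hC₁ : 0 ≤ C₁) (hC₂ : 0 ≤ C₂)
    (hWV : ∀ x ∈ ball (0 : E2) b, W (u x) ≤ C₂ * V (u x))
    (hDW : ∀ x ∈ ball (0 : E2) b, ‖fderiv ℝ W (u x)‖ ^ 2 ≤ C₁ * V (u x)) (hε1 : ε ≤ 1)
    {χ : E2 → ℝ} {L : ℝ} (hχ : ContDiff ℝ 1 χ) (hs : tsupport χ ⊆ ball 0 b)
    (hχ0 : ∀ x, 0 ≤ χ x) (hχ1 : ∀ x, χ x ≤ 1) (hL : ∀ i x, |pd i χ x| ≤ L) (i : Fin 2) :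
    ∫ x, |pd i (fun y => χ y * W (u y)) x| ≤
      (L * C₂ + C₁ / 2 + 1) * ∫ x in ball (0 : E2) b, eDens V ε u x := by
  have hud : Differentiable ℝ u := hu.differentiable (by simp)
  have hWd : Differentiable ℝ W := hW.differentiable (by simp)
  have hχd : Differentiable ℝ χ := hχ.differentiable (by simp)
  have hpd : ∀ x, pd i (fun y => χ y * W (u y)) x =
      pd i χ x * W (u x) + χ x * fderiv ℝ W (u x) (pd i u x) := fun x => by
    have hWu : DifferentiableAt ℝ (fun y => W (u y)) x := (hWd _).comp x (hud x)
    rw [pd_mul i (hχd x) hWu, pd_comp i (hWd _) (hud x)]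
  refine (le_abs_self _).trans
    (abs_integral_le_of_abs_le measurableSet_ball (fun x hx => ?_) (fun x hx => ?_) he)
  · have h1 : χ x = 0 := by
      by_contra hne
      exact hx (hs (subset_tsupport _ hne))
    rw [hpd, pd_eq_zero_of_notMem_tsupport (fun h => hx (hs h)), h1]
    simp
  · rw [abs_abs, hpd]
    have hL0 : 0 ≤ L := (abs_nonneg _).trans (hL i x)
    have h1 : |pd i χ x * W (u x)| ≤ L * (C₂ * eDens V ε u x) := by
      rw [abs_mul, abs_of_nonneg (hW0 _)]
      exact mul_le_mul (hL i x) ((hWV x hx).trans (mul_le_mul_of_nonneg_left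
        (potential_le_eDens_of_le_one h0 hε hε1 x) hC₂)) (hW0 _) hL0
    have h2 : |χ x * fderiv ℝ W (u x) (pd i u x)| ≤ (C₁ / 2 + 1) * eDens V ε u x := by
      rw [abs_mul, abs_of_nonneg (hχ0 x)]
      refine (mul_le_of_le_one_left (abs_nonneg _) (hχ1 x)).trans ?_
      exact abs_fderiv_apply_pd_le h0 hε hC₁ (hDW x hx) i
    refine (abs_add_le _ _).trans ?_
    linarith

lemma exists_stress_test (hV : ContDiff ℝ (⊤ : ℕ∞) V) (h0 : ∀ y, 0 ≤ V y)
    (hu : ContDiff ℝ (⊤ : ℕ∞) u) (hε : 0 < ε) (hε1 : ε ≤ 1) {b : ℝ}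
    (hpde : ∀ x ∈ ball (0 : E2) b, ∑ i, pd i (pd i u) x = (ε ^ 2)⁻¹ • gradient V (u x))
    (he : IntegrableOn (eDens V ε u) (ball 0 b)) {C₁ : ℝ} (hC₁ : 0 ≤ C₁)
    (hDV : ∀ x ∈ ball (0 : E2) b, ‖fderiv ℝ V (u x)‖ ^ 2 ≤ C₁ * V (u x))
    {χ : E2 → ℝ} {L : ℝ} (hχ : ContDiff ℝ 1 χ) (hc : HasCompactSupport χ)
    (hs : tsupport χ ⊆ ball 0 b) (hL : ∀ i x, |pd i χ x| ≤ L)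
    {ψ : E2 → ℝ} {L' : ℝ} (hψ : ContDiff ℝ 1 ψ) (hψc : HasCompactSupport ψ)
    (hψs : tsupport ψ ⊆ ball 0 b) (hψ0 : ∀ x, 0 ≤ ψ x) (hψ1 : ∀ x, ψ x ≤ 1)
    (hL' : ∀ i x, |pd i ψ x| ≤ L') (hχψ : ∀ x, χ x ≠ 0 → ψ x = 1) {τ : ℝ} (hτ : 0 < τ) :
    ∃ K : E2 → ℝ, Continuous K ∧
      |∫ x, χ x * K x| ≤ 12 * L * (L' + C₁ / 2 + 1) *
        ((∫ x in ball (0 : E2) b, eDens V ε u x) ^ 2 / τ) ∧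
      (∀ x, |K x| ≤ 6 * eDens V ε u x) ∧
      ∀ x, χ x ≠ 0 → τ ≤ V (u x) → K x = 2 * (ε⁻¹ * V (u x)) := by
  set w : E2 → ℝ := fun y => ψ y * V (u y) with hw
  have hVu : ContDiff ℝ 1 fun y => V (u y) := (hV.comp hu).of_le (by simp)
  have hw1 : ContDiff ℝ 1 w := hψ.mul hVu
  have hwc : HasCompactSupport w := hψc.mul_right
  set F : Fin 2 → ℝ → ℝ := fun i t => min 1 (lineVar i w t / τ) with hF
  have hFc : ∀ i, Continuous (F i) := fun i =>
    continuous_const.min ((continuous_lineVar hw1 hwc i).div_const τ)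
  have hF0 : ∀ i t, 0 ≤ F i t := fun i t =>
    le_min zero_le_one (div_nonneg (lineVar_nonneg i t) hτ.le)
  set Eb := ∫ x in ball (0 : E2) b, eDens V ε u x with hEb
  have hB : ∀ i t, |∫ s in (0 : ℝ)..t, F i s| ≤ (L' + C₁ / 2 + 1) * Eb / τ := by
    intro i t
    refine (abs_integral_le_of_le (hFc i) (hF0 i) ((integrable_lineVar hw1 hwc i).div_const τ)
      (fun t => min_le_right _ _) t).trans ?_
    rw [integral_div, integral_lineVar hw1 hwc]
    refine div_le_div_of_nonneg_right ?_ hτ.le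
    have h := integral_abs_pd_cutoff_le h0 hu hε he hV h0 hC₁ (C₂ := 1) zero_le_one
      (fun x _ => by simp) hDV hε1 hψ hψs hψ0 hψ1 hL' (1 - i)
    simpa using h
  have hsc : ∀ i, Continuous (stress V ε u i i) := fun i => (contDiff_stress hV hu i i).continuous
  have hterm : ∀ i, Continuous fun x : E2 => F i (x i) * stress V ε u i i x := fun i =>
    ((hFc i).comp (EuclideanSpace.proj i : E2 →L[ℝ] ℝ).continuous).mul (hsc i)
  refine ⟨fun x => ∑ i, F i (x i) * stress V ε u i i x, ?_, ?_, fun x => ?_, fun x hx hτx => ?_⟩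
  · exact continuous_finsetSum _ fun i _ => hterm i
  · have hInt : ∀ i, Integrable fun x => χ x * (F i (x i) * stress V ε u i i x) := fun i =>
      (hχ.continuous.mul (hterm i)).integrable_of_hasCompactSupport hc.mul_right
    have h := fun i => abs_integral_stress_le hV h0 hu hε hpde he hχ hc hs hL (hFc i) (hB i) i
    simp only [Fin.sum_univ_two, mul_add]
    rw [integral_add (hInt 0) (hInt 1)]
    refine (abs_add_le _ _).trans ((add_le_add (h 0) (h 1)).trans (le_of_eq ?_))
    ring
  · have h : ∀ i, |F i (x i) * stress V ε u i i x| ≤ 3 * eDens V ε u x := by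
      intro i
      rw [abs_mul, abs_of_nonneg (hF0 i _)]
      exact (mul_le_of_le_one_left (abs_nonneg _) (min_le_left _ _)).trans
        (abs_stress_le h0 hε i i x)
    beta_reduce
    rw [Fin.sum_univ_two]
    have h0 := h 0
    have h1 := h 1
    exact (abs_add_le _ _).trans (by linarith)
  · have hF1 : ∀ i, F i (x i) = 1 := by
      intro i
      refine min_eq_left ((one_le_div hτ).2 (hτx.trans ?_))
      have h := (le_abs_self _).trans (abs_le_lineVar hw1 hwc i x)
      simpa [hw, hχψ x hx] using h
    simp only [hF1, one_mul]
    exact sum_stress_diag x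

end StressTest

/-! ### Testing the equation for the potential -/

lemma exists_value_cutoff {c : ℝ} (hc : 0 < c) :
    ∃ η : ℝ → ℝ, ContDiff ℝ (⊤ : ℕ∞) η ∧ (∀ t, 0 ≤ η t) ∧ (∀ t, η t ≤ 1) ∧
      (∀ t ≤ c / 2, η t = 1) ∧ (∀ t, c ≤ t → η t = 0) ∧
      ∃ D ≥ 0, ∀ t ∈ Set.Icc (c / 2) c, |deriv η t| ≤ D := by
  have hs : ContDiff ℝ (⊤ : ℕ∞) fun t : ℝ => Real.smoothTransition (2 - 2 / c * t) :=
    Real.smoothTransition.contDiff.comp (by fun_prop)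
  obtain ⟨D, hD⟩ := (isCompact_Icc (a := c / 2) (b := c)).exists_bound_of_continuousOn
    (hs.continuous_deriv (by simp)).continuousOn
  refine ⟨_, hs, fun t => Real.smoothTransition.nonneg _, fun t => Real.smoothTransition.le_one _,
    fun t ht => Real.smoothTransition.one_of_one_le ?_,
    fun t ht => Real.smoothTransition.zero_of_nonpos ?_, max D 0, le_max_right _ _,
    fun t ht => (hD t ht).trans (le_max_left _ _)⟩
  · have : 2 / c * t ≤ 2 / c * (c / 2) := mul_le_mul_of_nonneg_left ht (by positivity)
    have e : 2 / c * (c / 2) = 1 := by field_simp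
    linarith
  · have : 2 / c * c ≤ 2 / c * t := mul_le_mul_of_nonneg_left ht (by positivity)
    have e : 2 / c * c = 2 := by field_simp
    linarith

section PotentialTest

variable {k : ℕ} {V : Evec k → ℝ} {ε : ℝ} {u : E2 → Evec k}

lemma hasDerivAt_mul_rpow {η : ℝ → ℝ} (hη : ContDiff ℝ (⊤ : ℕ∞) η) {τ β t : ℝ} (ht : 0 < τ + t) :
    HasDerivAt (fun t => η t * (τ + t) ^ (-β))
      (deriv η t * (τ + t) ^ (-β) - η t * (β * ((τ + t) ^ (-β) / (τ + t)))) t := by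
  have h1 : HasDerivAt η (deriv η t) t := (hη.differentiable (by simp) t).hasDerivAt
  have h2 : HasDerivAt (fun t => (τ + t) ^ (-β)) (1 * -β * (τ + t) ^ (-β - 1)) t :=
    ((hasDerivAt_id t).const_add τ).rpow_const (p := -β) (Or.inl ht.ne')
  rw [Real.rpow_sub_one ht.ne'] at h2
  refine (h1.mul h2).congr_deriv ?_
  ring

lemma contDiff_weight (hV : ContDiff ℝ (⊤ : ℕ∞) V) (h0 : ∀ y, 0 ≤ V y)
    (hu : ContDiff ℝ (⊤ : ℕ∞) u) {η : ℝ → ℝ} (hη : ContDiff ℝ (⊤ : ℕ∞) η) {τ β : ℝ} (hτ : 0 < τ) :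
    ContDiff ℝ (⊤ : ℕ∞) fun y => η (V (u y)) * (τ + V (u y)) ^ (-β) := by
  have hv : ContDiff ℝ (⊤ : ℕ∞) fun y => V (u y) := hV.comp hu
  exact (hη.comp hv).mul ((contDiff_const.add hv).rpow_const_of_ne fun x => by
    have := h0 (u x)
    positivity)

lemma divergence_weight_mul_pd (hV : ContDiff ℝ (⊤ : ℕ∞) V) (h0 : ∀ y, 0 ≤ V y)
    (hu : ContDiff ℝ (⊤ : ℕ∞) u) {x : E2}
    (hpde : ∑ i, pd i (pd i u) x = (ε ^ 2)⁻¹ • gradient V (u x))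
    {η : ℝ → ℝ} (hη : ContDiff ℝ (⊤ : ℕ∞) η) {τ β : ℝ} (hτ : 0 < τ) :
    ∑ i, pd i (fun y => η (V (u y)) * (τ + V (u y)) ^ (-β) * pd i (fun y => V (u y)) y) x =
      (deriv η (V (u x)) * (τ + V (u x)) ^ (-β) -
        η (V (u x)) * (β * ((τ + V (u x)) ^ (-β) / (τ + V (u x))))) *
          ∑ i, pd i (fun y => V (u y)) x ^ 2 +
      η (V (u x)) * (τ + V (u x)) ^ (-β) *
        (∑ i, fderiv ℝ (fderiv ℝ V) (u x) (pd i u x) (pd i u x) +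
          (ε ^ 2)⁻¹ * ‖fderiv ℝ V (u x)‖ ^ 2) := by
  have hv : ContDiff ℝ (⊤ : ℕ∞) fun y => V (u y) := hV.comp hu
  have hw := (contDiff_weight hV h0 hu hη (β := β) hτ).differentiable (by simp)
  have hpos : 0 < τ + V (u x) := by
    have := h0 (u x)
    positivity
  have h : ∀ i, pd i (fun y => η (V (u y)) * (τ + V (u y)) ^ (-β) * pd i (fun y => V (u y)) y) x =
      (deriv η (V (u x)) * (τ + V (u x)) ^ (-β) -
        η (V (u x)) * (β * ((τ + V (u x)) ^ (-β) / (τ + V (u x))))) *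
          pd i (fun y => V (u y)) x ^ 2 +
      η (V (u x)) * (τ + V (u x)) ^ (-β) * pd i (pd i (fun y => V (u y))) x := by
    intro i
    rw [pd_mul i (hw x) ((contDiff_pd hv i).differentiable (by simp) x),
      pd_comp_deriv (f := fun y => V (u y)) i (hasDerivAt_mul_rpow hη hpos)
        (hv.differentiable (by simp) x)]
    ring
  simp only [h, Finset.sum_add_distrib, ← Finset.mul_sum]
  rw [laplacian_potential hV hu hpde]

lemma le_divergence_weight {V₀ l C₁ β τ : ℝ} (hV : ContDiff ℝ (⊤ : ℕ∞) V) (h0 : ∀ y, 0 ≤ V y)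
    (hu : ContDiff ℝ (⊤ : ℕ∞) u) (hε : 0 < ε) {x : E2}
    (hpde : ∑ i, pd i (pd i u) x = (ε ^ 2)⁻¹ • gradient V (u x))
    (hV₀ : 0 < V₀)
    (hnd : ∀ y, V y ≤ V₀ →
      (∀ w, l * ‖w‖ ^ 2 ≤ fderiv ℝ (fderiv ℝ V) y w w) ∧ l * V y ≤ ‖fderiv ℝ V y‖ ^ 2)
    (hC₁ : 0 ≤ C₁) (hDV : ‖fderiv ℝ V (u x)‖ ^ 2 ≤ C₁ * V (u x))
    {η : ℝ → ℝ} (hη : ContDiff ℝ (⊤ : ℕ∞) η) (hη1 : ∀ t ≤ V₀ / 2, η t = 1)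
    (hβ : 0 < β) (hβl : β * C₁ ≤ l / 2) (hτ : 0 < τ) (hx : V (u x) < V₀ / 2) :
    l * (τ + V (u x)) ^ (-β) * eDens V ε u x ≤
      ε * ∑ i, pd i (fun y => η (V (u y)) * (τ + V (u y)) ^ (-β) *
        pd i (fun y => V (u y)) y) x := by
  rw [divergence_weight_mul_pd hV h0 hu hpde hη hτ]
  have hd : deriv η (V (u x)) = 0 := by
    have : η =ᶠ[𝓝 (V (u x))] fun _ => 1 :=
      (gt_mem_nhds hx).mono fun t ht => hη1 t (le_of_lt ht)
    rw [this.deriv_eq, deriv_const]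
  rw [hd, hη1 _ hx.le, eDens_eq]
  have hS := sum_sq_pd_potential_le (u := u) (hV.differentiable (by simp))
    (hu.differentiable (by simp)) hDV
  have hS0 : 0 ≤ ∑ i, pd i (fun y => V (u y)) x ^ 2 := Finset.sum_nonneg fun _ _ => sq_nonneg _
  obtain ⟨hH, hL⟩ := hnd (u x) (by linarith)
  have hHs : l * ∑ i, ‖pd i u x‖ ^ 2 ≤
      ∑ i, fderiv ℝ (fderiv ℝ V) (u x) (pd i u x) (pd i u x) := by
    rw [Finset.mul_sum]
    exact Finset.sum_le_sum fun i _ => hH _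
  have hv0 := h0 (u x)
  have hP0 : 0 ≤ ∑ i, ‖pd i u x‖ ^ 2 := Finset.sum_nonneg fun _ _ => sq_nonneg _
  set v := V (u x)
  set S := ∑ i, pd i (fun y => V (u y)) x ^ 2
  set P := ∑ i, ‖pd i u x‖ ^ 2
  set H := ∑ i, fderiv ℝ (fderiv ℝ V) (u x) (pd i u x) (pd i u x)
  set N := ‖fderiv ℝ V (u x)‖ ^ 2
  have hs : 0 < τ + v := by linarith
  have hq : 0 < (τ + v) ^ (-β) := Real.rpow_pos_of_pos hs _
  set q := (τ + v) ^ (-β)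
  have h1 : β * (S / (τ + v)) ≤ l / 2 * P := by
    have h2 : S / (τ + v) ≤ C₁ * P := by
      rw [div_le_iff₀ hs]
      have : 0 ≤ C₁ * P * τ := by positivity
      linarith
    calc β * (S / (τ + v)) ≤ β * (C₁ * P) := mul_le_mul_of_nonneg_left h2 hβ.le
      _ = β * C₁ * P := by ring
      _ ≤ l / 2 * P := mul_le_mul_of_nonneg_right hβl hP0
  have h2 : (ε ^ 2)⁻¹ * (l * v) ≤ (ε ^ 2)⁻¹ * N := mul_le_mul_of_nonneg_left hL (by positivity)
  have h3 : l / 2 * P + (ε ^ 2)⁻¹ * (l * v) ≤ H + (ε ^ 2)⁻¹ * N - β * (S / (τ + v)) := by linarith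
  have h4 := mul_le_mul_of_nonneg_left h3 (mul_pos hε hq).le
  calc l * q * (ε / 2 * P + ε⁻¹ * v) = ε * q * (l / 2 * P + (ε ^ 2)⁻¹ * (l * v)) := by
        field_simp
    _ ≤ _ := h4
    _ = _ := by ring

lemma neg_le_divergence_weight {V₀ l C₁ β τ D : ℝ} (hV : ContDiff ℝ (⊤ : ℕ∞) V)
    (h0 : ∀ y, 0 ≤ V y) (hu : ContDiff ℝ (⊤ : ℕ∞) u) (hε : 0 < ε) {x : E2}
    (hpde : ∑ i, pd i (pd i u) x = (ε ^ 2)⁻¹ • gradient V (u x))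
    (hV₀ : 0 < V₀) (hl : 0 < l)
    (hnd : ∀ y, V y ≤ V₀ →
      (∀ w, l * ‖w‖ ^ 2 ≤ fderiv ℝ (fderiv ℝ V) y w w) ∧ l * V y ≤ ‖fderiv ℝ V y‖ ^ 2)
    (hC₁ : 0 ≤ C₁) (hDV : ‖fderiv ℝ V (u x)‖ ^ 2 ≤ C₁ * V (u x))
    {η : ℝ → ℝ} (hη : ContDiff ℝ (⊤ : ℕ∞) η) (hη0 : ∀ t, 0 ≤ η t) (hηle : ∀ t, η t ≤ 1)
    (hηz : ∀ t, V₀ ≤ t → η t = 0) (hD : 0 ≤ D)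
    (hηD : ∀ t ∈ Set.Icc (V₀ / 2) V₀, |deriv η t| ≤ D)
    (hβ : 0 < β) (hτ : 0 < τ) (hx : V₀ / 2 ≤ V (u x)) :
    -(2 * (C₁ * V₀) * ((D + β * (2 / V₀)) * (V₀ / 2) ^ (-β))) * eDens V ε u x ≤
      ε * ∑ i, pd i (fun y => η (V (u y)) * (τ + V (u y)) ^ (-β) *
        pd i (fun y => V (u y)) y) x := by
  rw [divergence_weight_mul_pd hV h0 hu hpde hη hτ]
  have he := eDens_nonneg (u := u) h0 hε x
  have hQ : 0 < (V₀ / 2) ^ (-β) := Real.rpow_pos_of_pos (by linarith) _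
  rcases lt_or_ge V₀ (V (u x)) with hgt | hle
  · have hd : deriv η (V (u x)) = 0 := by
      have : η =ᶠ[𝓝 (V (u x))] fun _ => 0 :=
        (lt_mem_nhds hgt).mono fun t ht => hηz t (le_of_lt ht)
      rw [this.deriv_eq, deriv_const]
    rw [hd, hηz _ hgt.le]
    have : 0 ≤ (2 * (C₁ * V₀) * ((D + β * (2 / V₀)) * (V₀ / 2) ^ (-β))) * eDens V ε u x := by
      positivity
    simp only [zero_mul, sub_zero, add_zero, mul_zero]
    linarith
  · have hS := sum_sq_pd_potential_le (u := u) (hV.differentiable (by simp))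
      (hu.differentiable (by simp)) hDV
    have hS0 : 0 ≤ ∑ i, pd i (fun y => V (u y)) x ^ 2 := Finset.sum_nonneg fun _ _ => sq_nonneg _
    have hP0 : 0 ≤ ∑ i, ‖pd i u x‖ ^ 2 := Finset.sum_nonneg fun _ _ => sq_nonneg _
    have hH : 0 ≤ ∑ i, fderiv ℝ (fderiv ℝ V) (u x) (pd i u x) (pd i u x) :=
      Finset.sum_nonneg fun i _ => le_trans (by positivity) ((hnd (u x) hle).1 (pd i u x))
    have hP : ε / 2 * ∑ i, ‖pd i u x‖ ^ 2 ≤ eDens V ε u x := by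
      rw [eDens_eq]
      have : 0 ≤ ε⁻¹ * V (u x) := mul_nonneg (by positivity) (h0 _)
      linarith
    have hηx := hη0 (V (u x))
    have hηx1 := hηle (V (u x))
    have hdx := hηD _ ⟨hx, hle⟩
    set v := V (u x)
    set S := ∑ i, pd i (fun y => V (u y)) x ^ 2
    set P := ∑ i, ‖pd i u x‖ ^ 2
    set H := ∑ i, fderiv ℝ (fderiv ℝ V) (u x) (pd i u x) (pd i u x)
    set N := ‖fderiv ℝ V (u x)‖ ^ 2
    have hs : V₀ / 2 ≤ τ + v := by linarith
    have hs0 : 0 < τ + v := by linarith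
    have hq : 0 < (τ + v) ^ (-β) := Real.rpow_pos_of_pos hs0 _
    have hqQ : (τ + v) ^ (-β) ≤ (V₀ / 2) ^ (-β) :=
      Real.rpow_le_rpow_of_nonpos (by linarith) hs (by linarith)
    set q := (τ + v) ^ (-β)
    set Q := (V₀ / 2) ^ (-β)
    have h1 : 0 ≤ η v * q * (H + (ε ^ 2)⁻¹ * N) := by positivity
    have hinv : q / (τ + v) ≤ Q * (2 / V₀) := by
      rw [div_le_iff₀ hs0]
      calc q ≤ Q := hqQ
        _ = Q * (2 / V₀) * (V₀ / 2) := by field_simp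
        _ ≤ _ := mul_le_mul_of_nonneg_left hs (by positivity)
    have h2 : -((D + β * (2 / V₀)) * Q) ≤ deriv η v * q - η v * (β * (q / (τ + v))) := by
      have h3 : |deriv η v * q| ≤ D * Q := by
        rw [abs_mul, abs_of_pos hq]
        exact mul_le_mul hdx hqQ hq.le hD
      have h4 : η v * (β * (q / (τ + v))) ≤ β * (Q * (2 / V₀)) := by
        refine (mul_le_of_le_one_left (by positivity) hηx1).trans ?_
        exact mul_le_mul_of_nonneg_left hinv hβ.le
      have h5 := (abs_le.1 h3).1
      linarith
    set T := (D + β * (2 / V₀)) * Q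
    have hT : 0 ≤ T := by positivity
    have h3 : S ≤ C₁ * V₀ * P := hS.trans
      (mul_le_mul_of_nonneg_right (mul_le_mul_of_nonneg_left hle hC₁) hP0)
    have h4 : -T * (C₁ * V₀ * P) ≤ (deriv η v * q - η v * (β * (q / (τ + v)))) * S := by
      have h5 := mul_le_mul_of_nonneg_right h2 hS0
      have h6 := mul_le_mul_of_nonneg_left h3 hT
      linarith
    have h5 := mul_le_mul_of_nonneg_left hP (show 0 ≤ 2 * (C₁ * V₀) * T by positivity)
    have h6 := mul_le_mul_of_nonneg_left (add_le_add h4 h1) hε.le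
    linarith

lemma abs_integral_divergence_weight_le (hV : ContDiff ℝ (⊤ : ℕ∞) V) (h0 : ∀ y, 0 ≤ V y)
    (hu : ContDiff ℝ (⊤ : ℕ∞) u) (hε : 0 < ε) {b C₁ β τ : ℝ}
    (he : IntegrableOn (eDens V ε u) (ball 0 b)) (hC₁ : 0 ≤ C₁)
    (hDV : ∀ x ∈ ball (0 : E2) b, ‖fderiv ℝ V (u x)‖ ^ 2 ≤ C₁ * V (u x))
    {χ : E2 → ℝ} {L : ℝ} (hχ : ContDiff ℝ 1 χ) (hc : HasCompactSupport χ)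
    (hs : tsupport χ ⊆ ball 0 b) (hL : ∀ i x, |pd i χ x| ≤ L)
    {η : ℝ → ℝ} (hη : ContDiff ℝ (⊤ : ℕ∞) η) (hη0 : ∀ t, 0 ≤ η t) (hηle : ∀ t, η t ≤ 1)
    (hβ : 0 < β) (hτ : 0 < τ) :
    |∫ x, χ x * (ε * ∑ i, pd i (fun y => η (V (u y)) * (τ + V (u y)) ^ (-β) *
        pd i (fun y => V (u y)) y) x)| ≤
      2 * L * (C₁ / 2 + 1) * (ε * τ ^ (-β) * ∫ x in ball (0 : E2) b, eDens V ε u x) := by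
  have hv : ContDiff ℝ (⊤ : ℕ∞) fun y => V (u y) := hV.comp hu
  have h := abs_integral_mul_divergence_le (e := eDens V ε u)
    (X := fun i y => η (V (u y)) * (τ + V (u y)) ^ (-β) * pd i (fun y => V (u y)) y)
    (C := τ ^ (-β) * (C₁ / 2 + 1)) hχ hc hs hL
    (fun i => ((contDiff_weight hV h0 hu hη hτ).mul (contDiff_pd hv i)).of_le (by simp))
    (fun i x hx => ?_) he
  · have e1 : (fun x => χ x * (ε * ∑ i, pd i (fun y => η (V (u y)) * (τ + V (u y)) ^ (-β) *
        pd i (fun y => V (u y)) y) x)) = fun x => ε * (χ x * ∑ i, pd i (fun y => η (V (u y)) *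
        (τ + V (u y)) ^ (-β) * pd i (fun y => V (u y)) y) x) := by
      funext x; ring
    rw [e1, integral_const_mul, abs_mul, abs_of_pos hε]
    refine (mul_le_mul_of_nonneg_left h hε.le).trans (le_of_eq ?_)
    ring
  · have hpos := h0 (u x)
    have hq : 0 < (τ + V (u x)) ^ (-β) := Real.rpow_pos_of_pos (by linarith) _
    have hqle : (τ + V (u x)) ^ (-β) ≤ τ ^ (-β) :=
      Real.rpow_le_rpow_of_nonpos hτ (by linarith) (by linarith)
    rw [abs_mul, abs_of_nonneg (mul_nonneg (hη0 _) hq.le), mul_assoc (τ ^ (-β)),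
      pd_comp i (hV.differentiable (by simp) _) (hu.differentiable (by simp) _)]
    exact mul_le_mul ((mul_le_of_le_one_left hq.le (hηle _)).trans hqle)
      (abs_fderiv_apply_pd_le h0 hε hC₁ (hDV x hx) i) (abs_nonneg _) (by positivity)

lemma continuous_divergence_weight (hV : ContDiff ℝ (⊤ : ℕ∞) V) (h0 : ∀ y, 0 ≤ V y)
    (hu : ContDiff ℝ (⊤ : ℕ∞) u) {β τ : ℝ} {η : ℝ → ℝ} (hη : ContDiff ℝ (⊤ : ℕ∞) η)
    (hτ : 0 < τ) :
    Continuous fun x => ε * ∑ i, pd i (fun y => η (V (u y)) * (τ + V (u y)) ^ (-β) *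
        pd i (fun y => V (u y)) y) x := by
  have hv : ContDiff ℝ (⊤ : ℕ∞) fun y => V (u y) := hV.comp hu
  exact continuous_const.mul (continuous_finsetSum _ fun i _ => continuous_pd
    (((contDiff_weight hV h0 hu hη hτ).mul (contDiff_pd hv i)).of_le (by simp)) i)

end PotentialTest

/-! ### The decay step -/

lemma half_le_two_rpow_neg {β s : ℝ} (hβ : 0 ≤ β) (hβ1 : β ≤ 1) (hs : 0 < s) (hs2 : s ≤ 2) :
    1 / 2 ≤ s ^ (-β) := by
  have h1 : (2 : ℝ) ^ (-(1 : ℝ)) ≤ 2 ^ (-β) :=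
    Real.rpow_le_rpow_of_exponent_le one_le_two (by linarith)
  have h2 : (2 : ℝ) ^ (-β) ≤ s ^ (-β) := Real.rpow_le_rpow_of_nonpos hs hs2 (by linarith)
  rw [Real.rpow_neg_one] at h1
  linarith

lemma density_le_of_tests {e v w J K I l c τ β K₀ C₂ : ℝ} (he : 0 ≤ e) (hv : 0 ≤ v) (hw : 0 ≤ w)
    (hl : 0 < l) (hc1 : c ≤ 1) (hτ : 0 < τ) (hτc : τ ≤ c) (hβ : 0 < β) (hβ1 : β ≤ 1)
    (hK₀ : 0 ≤ K₀) (hC₂ : 0 ≤ C₂) (hJ : v < c → l * (1 + v) ^ (-β) * e ≤ J)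
    (hJ' : c ≤ v → -K₀ * e ≤ J) (hI : v < c → l * (τ + v) ^ (-β) * e ≤ I)
    (hI' : c ≤ v → -K₀ * e ≤ I) (hK : |K| ≤ 6 * e) (hKτ : τ ≤ v → K = 2 * w)
    (hev : c ≤ v → e ≤ C₂ * w) :
    e ≤ 2 / l * J + C₂ * (1 + 2 / l * K₀) * K +
      2 / l * (1 + 6 * (C₂ * (1 + 2 / l * K₀))) * (τ ^ β * I + K₀ * (τ ^ β * e)) := by
  have hτβ : 0 < τ ^ β := Real.rpow_pos_of_pos hτ _
  set d := 2 / l with hd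
  have hd0 : 0 < d := by positivity
  have hdl : d * l = 2 := by rw [hd]; field_simp
  have hb : 0 ≤ C₂ * (1 + d * K₀) := by positivity
  have hKe : 0 ≤ K₀ * (τ ^ β * e) := by positivity
  rcases lt_or_ge v c with hvc | hcv
  · have hJ0 := hJ hvc
    have hI0 := hI hvc
    have hJe : e ≤ d * J := by
      have h1 := half_le_two_rpow_neg hβ.le hβ1 (show 0 < 1 + v by linarith) (by linarith)
      calc e = d * (l * (1 / 2) * e) := by linear_combination (-(1 / 2) * e) * hdl
        _ ≤ d * (l * (1 + v) ^ (-β) * e) := by gcongr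
        _ ≤ d * J := by gcongr
    have hIpos : 0 ≤ I := le_trans (by
      have := Real.rpow_pos_of_pos (show 0 < τ + v by linarith) (-β)
      positivity) hI0
    rcases lt_or_ge v τ with hvτ | hτv
    · have h1 : e ≤ d * (τ ^ β * I) := by
        have h2 : 1 / 2 ≤ τ ^ β * (τ + v) ^ (-β) := by
          have h3 : τ ^ β * (τ + v) ^ (-β) = (1 + v / τ) ^ (-β) := by
            have h4 : τ + v = τ * (1 + v / τ) := by field_simp
            rw [h4, Real.mul_rpow hτ.le (by positivity), ← mul_assoc, ← Real.rpow_add hτ]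
            simp
          rw [h3]
          refine half_le_two_rpow_neg hβ.le hβ1 (by positivity) ?_
          have : v / τ ≤ 1 := (div_le_one hτ).2 hvτ.le
          linarith
        calc e = d * (l * (1 / 2) * e) := by linear_combination (-(1 / 2) * e) * hdl
          _ ≤ d * (l * (τ ^ β * (τ + v) ^ (-β)) * e) := by gcongr
          _ = d * (τ ^ β * (l * (τ + v) ^ (-β) * e)) := by ring
          _ ≤ d * (τ ^ β * I) := by gcongr
      have h2 : -(6 * e) ≤ K := (abs_le.1 hK).1
      set b := C₂ * (1 + d * K₀)
      have h3 := mul_le_mul_of_nonneg_left h2 hb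
      have h4 := mul_le_mul_of_nonneg_left h1 (show 0 ≤ 1 + 6 * b by positivity)
      have h5 : 0 ≤ d * (1 + 6 * b) * (K₀ * (τ ^ β * e)) := by positivity
      linarith
    · rw [hKτ hτv]
      have : 0 ≤ C₂ * (1 + d * K₀) * (2 * w) := by positivity
      have : 0 ≤ d * (1 + 6 * (C₂ * (1 + d * K₀))) * (τ ^ β * I + K₀ * (τ ^ β * e)) := by
        positivity
      linarith
  · have h1 := hJ' hcv
    have h2 := hI' hcv
    have h3 := hev hcv
    rw [hKτ (hτc.trans hcv)]
    have h4 := mul_le_mul_of_nonneg_left h1 hd0.le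
    have h5 := mul_le_mul_of_nonneg_left h2 hτβ.le
    have h6 : 0 ≤ d * (1 + 6 * (C₂ * (1 + d * K₀))) * (τ ^ β * I + K₀ * (τ ^ β * e)) :=
      mul_nonneg (by positivity) (by linarith)
    have h7 : (1 + d * K₀) * e ≤ (1 + d * K₀) * (C₂ * w) := by gcongr
    have h8 : 0 ≤ (1 + d * K₀) * (C₂ * w) := by positivity
    linarith

section DecayStep

variable {k : ℕ} {V : Evec k → ℝ}

lemma eDens_le_of_pd_le {ε Cg c : ℝ} {u : E2 → Evec k} (hε : 0 < ε) (hc : 0 < c) {x : E2}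
    (hpd : ∀ i, ‖pd i u x‖ ≤ Cg / ε) (hx : c ≤ V (u x)) :
    eDens V ε u x ≤ (Cg ^ 2 / c + 1) * (ε⁻¹ * V (u x)) := by
  have h1 : ∀ i, ‖pd i u x‖ ^ 2 ≤ (Cg / ε) ^ 2 := fun i =>
    pow_le_pow_left₀ (norm_nonneg _) (hpd i) 2
  have h2 : ∑ i, ‖pd i u x‖ ^ 2 ≤ 2 * (Cg / ε) ^ 2 := by
    rw [Fin.sum_univ_two]
    linarith [h1 0, h1 1]
  have h3 : ε / 2 * ∑ i, ‖pd i u x‖ ^ 2 ≤ ε⁻¹ * Cg ^ 2 := by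
    refine (mul_le_mul_of_nonneg_left h2 (by positivity)).trans (le_of_eq ?_)
    field_simp
  have h4 : ε⁻¹ * Cg ^ 2 ≤ Cg ^ 2 / c * (ε⁻¹ * V (u x)) := by
    calc ε⁻¹ * Cg ^ 2 = Cg ^ 2 / c * (ε⁻¹ * c) := by field_simp
      _ ≤ _ := by gcongr
  rw [eDens_eq]
  linarith

/-- The energy on a smaller disk, in terms of a truncation level `τ` for the potential. -/
lemma exists_decay_of_level (hV : IsMultiWell V) (M Cg : ℝ) :
    ∃ c > (0 : ℝ), c ≤ 1 ∧ ∃ β > (0 : ℝ), β ≤ 1 ∧ ∀ a b : ℝ, 0 < a → a < b → ∃ C > (0 : ℝ),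
      ∀ (ε : ℝ) (u : E2 → Evec k), 0 < ε → ε ≤ 1 → ContDiff ℝ (⊤ : ℕ∞) u →
        (∀ x ∈ ball (0 : E2) b, ∑ i, pd i (pd i u) x = (ε ^ 2)⁻¹ • gradient V (u x)) →
        IntegrableOn (eDens V ε u) (ball 0 b) → (∀ x ∈ ball (0 : E2) b, ‖u x‖ ≤ M) →
        (∀ x ∈ ball (0 : E2) b, ∀ i, ‖pd i u x‖ ≤ Cg / ε) → ∀ τ, 0 < τ → τ ≤ c →
        energy V ε u (ball 0 a) ≤ C * (ε * energy V ε u (ball 0 b) +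
          energy V ε u (ball 0 b) ^ 2 / τ + τ ^ β * energy V ε u (ball 0 b)) := by
  have hVs := hV.smooth
  have h0 := hV.nonneg
  obtain ⟨C₁, hC₁, hDV⟩ := exists_sq_norm_fderiv_le hVs h0 M
  obtain ⟨V₁, hV₁, l, hl, hnd₁⟩ := exists_sublevel_nondegenerate hV
  obtain ⟨V₀, hV₀, hV₀1, hV₀V⟩ : ∃ V₀ > 0, V₀ ≤ 1 ∧ V₀ ≤ V₁ :=
    ⟨min 1 V₁, lt_min one_pos hV₁, min_le_left _ _, min_le_right _ _⟩
  have hnd : ∀ y, V y ≤ V₀ →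
      (∀ w, l * ‖w‖ ^ 2 ≤ fderiv ℝ (fderiv ℝ V) y w w) ∧ l * V y ≤ ‖fderiv ℝ V y‖ ^ 2 :=
    fun y hy => hnd₁ y (hy.trans hV₀V)
  obtain ⟨η, hη, hη0, hηle, hη1, hηz, D, hD, hηD⟩ := exists_value_cutoff hV₀
  obtain ⟨β, hβ, hβ1, hβl⟩ : ∃ β > (0 : ℝ), β ≤ 1 ∧ β * C₁ ≤ l / 2 := by
    refine ⟨min 1 (l / 2 / C₁), by positivity, min_le_left _ _, ?_⟩
    rw [← le_div_iff₀ hC₁]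
    exact min_le_right _ _
  refine ⟨V₀ / 2, by positivity, by linarith, β, hβ, hβ1, fun a b ha hab => ?_⟩
  obtain ⟨χ, hχ, hχc, hχs, hχ1, hχ0, hχle, L, hL0, hL⟩ := exists_cutoff ha
    (show a < (a + b) / 2 by linarith)
  obtain ⟨ψ, hψ, hψc, hψs, hψ1, hψ0, hψle, L', hL'0, hL'⟩ := exists_cutoff
    (show 0 < (a + b) / 2 by linarith) (show (a + b) / 2 < b by linarith)
  have hχb : tsupport χ ⊆ ball 0 b := hχs.trans (ball_subset_ball (by linarith))
  have hχx : ∀ x, χ x ≠ 0 → x ∈ ball (0 : E2) ((a + b) / 2) := fun x hx =>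
    hχs (subset_tsupport _ hx)
  have hχψ : ∀ x, χ x ≠ 0 → ψ x = 1 := fun x hx => hψ1 x (ball_subset_closedBall (hχx x hx))
  set K₀ := 2 * (C₁ * V₀) * ((D + β * (2 / V₀)) * (V₀ / 2) ^ (-β)) with hK₀
  have hK₀0 : 0 ≤ K₀ := by positivity
  set C₂ := Cg ^ 2 / (V₀ / 2) + 1 with hC₂
  have hC₂0 : 0 ≤ C₂ := by positivity
  set B := C₂ * (1 + 2 / l * K₀) with hB
  have hB0 : 0 ≤ B := by positivity
  set A := 2 / l * (1 + 6 * B) with hA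
  have hA0 : 0 ≤ A := by positivity
  set Q := 2 * L * (C₁ / 2 + 1) with hQ
  have hQ0 : 0 ≤ Q := by positivity
  set R := 12 * L * (L' + C₁ / 2 + 1) with hR
  have hR0 : 0 ≤ R := by positivity
  refine ⟨2 / l * Q + A * Q + B * R + A * K₀ + 1, by positivity, ?_⟩
  intro ε u hε hε1 hu hpde he hM hCg τ hτ hτc
  have hχ' : ContDiff ℝ 1 χ := hχ.of_le (by simp)
  have hψ' : ContDiff ℝ 1 ψ := hψ.of_le (by simp)
  have hDVu : ∀ x ∈ ball (0 : E2) b, ‖fderiv ℝ V (u x)‖ ^ 2 ≤ C₁ * V (u x) := fun x hx =>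
    hDV _ (hM x hx)
  obtain ⟨K, hKc, hKint, hKle, hKτ⟩ := exists_stress_test hVs h0 hu hε hε1 hpde he hC₁.le hDVu
    hχ' hχc hχb hL hψ' hψc hψs hψ0 hψle hL' hχψ hτ
  set I : ℝ → E2 → ℝ := fun τ x => ε * ∑ i, pd i (fun y => η (V (u y)) *
    (τ + V (u y)) ^ (-β) * pd i (fun y => V (u y)) y) x with hI
  have hIc : ∀ τ, 0 < τ → Continuous (I τ) := fun τ hτ =>
    continuous_divergence_weight hVs h0 hu hη hτ
  have hIint : ∀ τ, 0 < τ → |∫ x, χ x * I τ x| ≤ Q * (ε * τ ^ (-β) * energy V ε u (ball 0 b)) :=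
    fun τ hτ => abs_integral_divergence_weight_le hVs h0 hu hε he hC₁.le hDVu hχ' hχc hχb hL hη
      hη0 hηle hβ hτ
  have hpt : ∀ x, χ x * eDens V ε u x ≤ 2 / l * (χ x * I 1 x) + B * (χ x * K x) +
      A * (τ ^ β * (χ x * I τ x) + K₀ * (τ ^ β * (χ x * eDens V ε u x))) := by
    intro x
    by_cases hx : χ x = 0
    · simp [hx]
    · have hxb : x ∈ ball (0 : E2) b := ball_subset_ball (by linarith) (hχx x hx)
      have hlow : ∀ τ, 0 < τ → V (u x) < V₀ / 2 →
          l * (τ + V (u x)) ^ (-β) * eDens V ε u x ≤ I τ x := fun τ hτ hv =>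
        le_divergence_weight hVs h0 hu hε (hpde x hxb) hV₀ hnd hC₁.le (hDVu x hxb) hη hη1 hβ hβl
          hτ hv
      have hhigh : ∀ τ, 0 < τ → V₀ / 2 ≤ V (u x) → -K₀ * eDens V ε u x ≤ I τ x := fun τ hτ hv =>
        neg_le_divergence_weight hVs h0 hu hε (hpde x hxb) hV₀ hl hnd hC₁.le (hDVu x hxb) hη hη0
          hηle hηz hD hηD hβ hτ hv
      have h := density_le_of_tests (eDens_nonneg h0 hε x) (h0 (u x))
        (mul_nonneg (inv_pos.2 hε).le (h0 (u x))) hl (by linarith) hτ hτc hβ hβ1 hK₀0 hC₂0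
        (hlow 1 one_pos) (hhigh 1 one_pos) (hlow τ hτ) (hhigh τ hτ) (hKle x) (hKτ x hx)
        (fun hv => eDens_le_of_pd_le hε (by positivity) (hCg x hxb) hv)
      have h2 := mul_le_mul_of_nonneg_left h (hχ0 x)
      linarith
  have hec : Continuous (eDens V ε u) := (contDiff_eDens hVs hu).continuous
  have hInt : ∀ f : E2 → ℝ, Continuous f → Integrable fun x => χ x * f x := fun f hf =>
    (hχ.continuous.mul hf).integrable_of_hasCompactSupport hχc.mul_right
  have hi1 := hInt _ (hIc 1 one_pos)
  have hi2 := hInt _ hKc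
  have hi3 := hInt _ (hIc τ hτ)
  have hi4 := hInt _ hec
  have j1 : Integrable fun x => 2 / l * (χ x * I 1 x) + B * (χ x * K x) :=
    (hi1.const_mul _).add (hi2.const_mul _)
  have j2 : Integrable fun x => τ ^ β * (χ x * I τ x) + K₀ * (τ ^ β * (χ x * eDens V ε u x)) :=
    (hi3.const_mul _).add ((hi4.const_mul _).const_mul _)
  have hmono := integral_mono hi4 (j1.add (j2.const_mul A)) hpt
  have hexp : ∫ x, (2 / l * (χ x * I 1 x) + B * (χ x * K x) +
      A * (τ ^ β * (χ x * I τ x) + K₀ * (τ ^ β * (χ x * eDens V ε u x)))) =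
      2 / l * (∫ x, χ x * I 1 x) + B * (∫ x, χ x * K x) +
      A * (τ ^ β * (∫ x, χ x * I τ x) + K₀ * (τ ^ β * ∫ x, χ x * eDens V ε u x)) := by
    rw [integral_add j1 (j2.const_mul A),
      integral_add (hi1.const_mul (2 / l)) (hi2.const_mul B), integral_const_mul,
      integral_const_mul, integral_const_mul,
      integral_add (hi3.const_mul (τ ^ β)) ((hi4.const_mul (τ ^ β)).const_mul K₀),
      integral_const_mul, integral_const_mul, integral_const_mul]
  have hmono' := hmono.trans_eq hexp
  have he0 := fun x => eDens_nonneg (u := u) h0 hε x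
  have hEa : energy V ε u (ball 0 a) ≤ ∫ x, χ x * eDens V ε u x := by
    have h1 : energy V ε u (ball 0 a) = ∫ x in ball (0 : E2) a, χ x * eDens V ε u x :=
      setIntegral_congr_fun measurableSet_ball fun x hx => by
        simp [hχ1 x (ball_subset_closedBall hx)]
    rw [h1]
    exact setIntegral_le_integral hi4 (Eventually.of_forall fun x => mul_nonneg (hχ0 x) (he0 x))
  have hEb : ∫ x, χ x * eDens V ε u x ≤ energy V ε u (ball 0 b) := by
    have h := abs_integral_le_of_abs_le (f := fun x => χ x * eDens V ε u x) (e := eDens V ε u)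
      (s := ball 0 b) (C := 1) measurableSet_ball
      (fun x hx => by
        have : χ x = 0 := by
          by_contra hne
          exact hx (hχb (subset_tsupport _ hne))
        simp [this])
      (fun x _ => by
        rw [abs_of_nonneg (mul_nonneg (hχ0 x) (he0 x))]
        exact mul_le_mul_of_nonneg_right (hχle x) (he0 x)) he
    rw [one_mul] at h
    exact (le_abs_self _).trans h
  have hE0 : 0 ≤ energy V ε u (ball 0 b) := integral_nonneg he0
  change |∫ x, χ x * K x| ≤ R * (energy V ε u (ball 0 b) ^ 2 / τ) at hKint
  set E := energy V ε u (ball 0 b)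
  have hτβ : 0 < τ ^ β := Real.rpow_pos_of_pos hτ _
  have b1 : 2 / l * (∫ x, χ x * I 1 x) ≤ 2 / l * (Q * (ε * E)) := by
    refine mul_le_mul_of_nonneg_left ((le_abs_self _).trans ((hIint 1 one_pos).trans ?_))
      (by positivity)
    rw [Real.one_rpow, mul_one]
  have b2' : B * (∫ x, χ x * K x) ≤ B * (R * (E ^ 2 / τ)) :=
    mul_le_mul_of_nonneg_left ((le_abs_self _).trans hKint) hB0
  have b3 : τ ^ β * (∫ x, χ x * I τ x) ≤ Q * (ε * E) := by
    refine (mul_le_mul_of_nonneg_left ((le_abs_self _).trans (hIint τ hτ)) hτβ.le).trans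
      (le_of_eq ?_)
    rw [Real.rpow_neg hτ.le]
    field_simp
  have b4 : K₀ * (τ ^ β * ∫ x, χ x * eDens V ε u x) ≤ K₀ * (τ ^ β * E) := by gcongr
  have b5 := mul_le_mul_of_nonneg_left (add_le_add b3 b4) hA0
  have hX : 0 ≤ ε * E := by positivity
  have hY : 0 ≤ E ^ 2 / τ := by positivity
  have hZ : 0 ≤ τ ^ β * E := by positivity
  refine (hEa.trans hmono').trans ((add_le_add (add_le_add b1 b2') b5).trans ?_)
  set X := ε * E
  set Y := E ^ 2 / τ
  set Z := τ ^ β * E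
  have p1 : 0 ≤ (B * R + A * K₀ + 1) * X := by positivity
  have p2 : 0 ≤ (2 / l * Q + A * Q + A * K₀ + 1) * Y := by positivity
  have p3 : 0 ≤ (2 / l * Q + A * Q + B * R + 1) * Z := by positivity
  linarith

end DecayStep

section Iteration

variable {k : ℕ} {V : Evec k → ℝ}

/-- A smooth map solving the system on the disk of radius `b`, with finite energy there and with
bounds on the map and on its gradient. -/
structure IsBoundedSolution (V : Evec k → ℝ) (M Cg ε b : ℝ) (u : E2 → Evec k) : Prop where
  pos : 0 < ε
  le_one : ε ≤ 1
  smooth : ContDiff ℝ (⊤ : ℕ∞) u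
  pde : ∀ x ∈ ball (0 : E2) b, ∑ i, pd i (pd i u) x = (ε ^ 2)⁻¹ • gradient V (u x)
  integrableOn : IntegrableOn (eDens V ε u) (ball 0 b)
  norm_le : ∀ x ∈ ball (0 : E2) b, ‖u x‖ ≤ M
  norm_pd_le : ∀ x ∈ ball (0 : E2) b, ∀ i, ‖pd i u x‖ ≤ Cg / ε

lemma IsBoundedSolution.mono {M Cg ε a b : ℝ} {u : E2 → Evec k}
    (h : IsBoundedSolution V M Cg ε b u) (hab : a ≤ b) : IsBoundedSolution V M Cg ε a u where
  pos := h.pos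
  le_one := h.le_one
  smooth := h.smooth
  pde x hx := h.pde x (ball_subset_ball hab hx)
  integrableOn := h.integrableOn.mono_set (ball_subset_ball hab)
  norm_le x hx := h.norm_le x (ball_subset_ball hab hx)
  norm_pd_le x hx := h.norm_pd_le x (ball_subset_ball hab hx)

lemma energy_nonneg (h0 : ∀ y, 0 ≤ V y) {ε : ℝ} (hε : 0 < ε) (u : E2 → Evec k) (s : Set E2) :
    0 ≤ energy V ε u s :=
  integral_nonneg fun x => eDens_nonneg h0 hε x

lemma energy_mono (h0 : ∀ y, 0 ≤ V y) {ε : ℝ} (hε : 0 < ε) {u : E2 → Evec k} {s t : Set E2}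
    (ht : IntegrableOn (eDens V ε u) t) (hst : s ⊆ t) : energy V ε u s ≤ energy V ε u t :=
  setIntegral_mono_set ht (Eventually.of_forall fun x => eDens_nonneg h0 hε x)
    hst.eventuallyLE

lemma exists_superlinear_decay (hV : IsMultiWell V) (M Cg : ℝ) :
    ∃ p > (1 : ℝ), ∀ a b : ℝ, 0 < a → a < b → ∃ C > (0 : ℝ),
      ∀ (ε : ℝ) (u : E2 → Evec k), IsBoundedSolution V M Cg ε b u →
        energy V ε u (ball 0 b) ≤ 1 → energy V ε u (ball 0 a) ≤
          C * (energy V ε u (ball 0 b) ^ p + ε * energy V ε u (ball 0 b)) := by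
  obtain ⟨c, hc, hc1, β, hβ, hβ1, h⟩ := exists_decay_of_level hV M Cg
  refine ⟨1 + β / 2, by linarith, fun a b ha hab => ?_⟩
  obtain ⟨C, hC, h⟩ := h a b ha hab
  refine ⟨C * (1 / c + 1), by positivity, fun ε u hu hE1 => ?_⟩
  have hEa := energy_mono hV.nonneg hu.pos hu.integrableOn (ball_subset_ball hab.le)
  have hE0 := energy_nonneg hV.nonneg hu.pos u (ball 0 b)
  have h := h ε u hu.pos hu.le_one hu.smooth hu.pde hu.integrableOn hu.norm_le hu.norm_pd_le
  set E := energy V ε u (ball 0 b)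
  have hε := hu.pos
  rcases hE0.eq_or_lt with hE | hE
  · rw [← hE] at hEa ⊢
    refine hEa.trans ?_
    positivity
  · set s := E ^ (1 / 2 : ℝ) with hs
    have hs0 : 0 < s := Real.rpow_pos_of_pos hE _
    have hs1 : s ≤ 1 := Real.rpow_le_one hE0 hE1 (by norm_num)
    have hsE : s ^ 2 = E := by
      rw [hs, ← Real.rpow_natCast, ← Real.rpow_mul hE0]
      norm_num
    have h1 := h (c * s) (by positivity) (by nlinarith)
    have hp : E ^ (1 + β / 2) = E * s ^ β := by
      rw [hs, ← Real.rpow_mul hE0, Real.rpow_add hE, Real.rpow_one]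
      ring_nf
    have hsβ : s ≤ s ^ β := by
      simpa using Real.rpow_le_rpow_of_exponent_ge hs0 hs1 hβ1
    have h2 : E ^ 2 / (c * s) ≤ 1 / c * E ^ (1 + β / 2) := by
      have : E ^ 2 / (c * s) = 1 / c * (E * s) := by
        rw [← hsE]
        field_simp
      rw [this, hp]
      gcongr
    have h3 : (c * s) ^ β * E ≤ E ^ (1 + β / 2) := by
      rw [hp, mul_comm]
      gcongr
      nlinarith
    have h4 : 0 ≤ 1 / c * (ε * E) := by positivity
    calc energy V ε u (ball 0 a) ≤ _ := h1
      _ ≤ C * (ε * E + 1 / c * E ^ (1 + β / 2) + E ^ (1 + β / 2)) := by gcongr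
      _ ≤ C * (1 / c + 1) * (E ^ (1 + β / 2) + ε * E) := by
        rw [mul_assoc]
        gcongr
        linarith

lemma add_rpow_le_two_rpow_mul {x y p : ℝ} (hx : 0 ≤ x) (hy : 0 ≤ y) (hp : 0 ≤ p) :
    (x + y) ^ p ≤ 2 ^ p * (x ^ p + y ^ p) := by
  rcases le_total x y with h | h
  · calc (x + y) ^ p ≤ (2 * y) ^ p := by gcongr; linarith
      _ = 2 ^ p * y ^ p := Real.mul_rpow (by norm_num) hy
      _ ≤ _ := by
        gcongr
        have := Real.rpow_nonneg hx p
        linarith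
  · calc (x + y) ^ p ≤ (2 * x) ^ p := by gcongr; linarith
      _ = 2 ^ p * x ^ p := Real.mul_rpow (by norm_num) hx
      _ ≤ _ := by
        gcongr
        have := Real.rpow_nonneg hy p
        linarith

lemma exists_decay_pow (hV : IsMultiWell V) (M Cg : ℝ) :
    ∃ p > (1 : ℝ), ∀ (n : ℕ) (a b : ℝ), 0 < a → a < b → ∃ C > (0 : ℝ),
      ∀ (ε : ℝ) (u : E2 → Evec k), IsBoundedSolution V M Cg ε b u →
        energy V ε u (ball 0 b) ≤ 1 → energy V ε u (ball 0 a) ≤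
          C * (energy V ε u (ball 0 b) ^ p ^ n + ε * energy V ε u (ball 0 b)) := by
  obtain ⟨p, hp, h⟩ := exists_superlinear_decay hV M Cg
  refine ⟨p, hp, fun n => ?_⟩
  induction n with
  | zero =>
    refine fun a b _ hab => ⟨1, one_pos, fun ε u hu _ => ?_⟩
    have hEa := energy_mono hV.nonneg hu.pos hu.integrableOn (ball_subset_ball hab.le)
    have h0 := mul_nonneg hu.pos.le (energy_nonneg hV.nonneg hu.pos u (ball 0 b))
    rw [pow_zero, Real.rpow_one]
    linarith
  | succ n ih =>
    intro a b ha hab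
    obtain ⟨C₁, hC₁, h₁⟩ := h a ((a + b) / 2) ha (by linarith)
    obtain ⟨C₂, hC₂, h₂⟩ := ih ((a + b) / 2) b (by linarith) (by linarith)
    refine ⟨C₁ * (C₂ ^ p * 2 ^ p + 1), by positivity, fun ε u hu hE1 => ?_⟩
    have hm := hu.mono (show (a + b) / 2 ≤ b by linarith)
    have hEm := energy_mono hV.nonneg hu.pos hu.integrableOn
      (ball_subset_ball (show (a + b) / 2 ≤ b by linarith))
    have hE0 := energy_nonneg hV.nonneg hu.pos u (ball 0 b)
    have hm0 := energy_nonneg hV.nonneg hu.pos u (ball 0 ((a + b) / 2))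
    have h₁ := h₁ ε u hm (hEm.trans hE1)
    have h₂ := h₂ ε u hu hE1
    have hε := hu.pos
    set E := energy V ε u (ball 0 b)
    set F := energy V ε u (ball 0 ((a + b) / 2))
    have hεE : (ε * E) ^ p ≤ ε * E :=
      Real.rpow_le_self_of_le_one (by positivity) (mul_le_one₀ hu.le_one hE0 hE1) hp.le
    have hF : F ^ p ≤ C₂ ^ p * 2 ^ p * (E ^ p ^ (n + 1) + ε * E) :=
      calc F ^ p ≤ (C₂ * (E ^ p ^ n + ε * E)) ^ p := by gcongr
        _ = C₂ ^ p * (E ^ p ^ n + ε * E) ^ p := Real.mul_rpow hC₂.le (by positivity)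
        _ ≤ C₂ ^ p * (2 ^ p * ((E ^ p ^ n) ^ p + (ε * E) ^ p)) := by
          gcongr
          exact add_rpow_le_two_rpow_mul (by positivity) (by positivity) (by linarith)
        _ ≤ C₂ ^ p * (2 ^ p * (E ^ p ^ (n + 1) + ε * E)) := by
          rw [← Real.rpow_mul hE0, ← pow_succ]
          gcongr
        _ = _ := by ring
    have hG : ε * F ≤ E ^ p ^ (n + 1) + ε * E :=
      (mul_le_mul_of_nonneg_left hEm hε.le).trans (le_add_of_nonneg_left (by positivity))
    calc energy V ε u (ball 0 a) ≤ C₁ * (F ^ p + ε * F) := h₁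
      _ ≤ C₁ * (C₂ ^ p * 2 ^ p * (E ^ p ^ (n + 1) + ε * E) +
          (E ^ p ^ (n + 1) + ε * E)) := by gcongr
      _ = _ := by ring

/-- Energy decay for solutions with a bound on the map and on its gradient. -/
lemma exists_decay_of_isBoundedSolution (hV : IsMultiWell V) (M Cg : ℝ) {a b : ℝ} (ha : 0 < a)
    (hab : a < b) : ∃ C > (0 : ℝ), ∀ (ε : ℝ) (u : E2 → Evec k), IsBoundedSolution V M Cg ε b u →
      energy V ε u (ball 0 b) ≤ 1 → energy V ε u (ball 0 a) ≤
        C * (energy V ε u (ball 0 b) ^ (3 / 2 : ℝ) + ε * energy V ε u (ball 0 b)) := by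
  obtain ⟨p, hp, h⟩ := exists_decay_pow hV M Cg
  obtain ⟨n, hn⟩ := pow_unbounded_of_one_lt (3 / 2) hp
  obtain ⟨C, hC, h⟩ := h n a b ha hab
  refine ⟨C, hC, fun ε u hu hE1 => (h ε u hu hE1).trans ?_⟩
  have hE0 := energy_nonneg hV.nonneg hu.pos u (ball 0 b)
  gcongr C * (?_ + _)
  rcases hE0.eq_or_lt with hE | hE
  · rw [← hE, Real.zero_rpow (by positivity), Real.zero_rpow (by norm_num)]
  · exact Real.rpow_le_rpow_of_exponent_ge hE hE1 hn.le

end Iteration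

/-! ### Bounds on solutions of small energy -/

section SupBound

variable {k : ℕ} {V : Evec k → ℝ}

lemma norm_le_of_abs_coord_le {x : E2} {r s : ℝ} (hs : 0 ≤ s) (hrs : 2 * r ^ 2 ≤ s ^ 2)
    (hx : ∀ i, |x i| ≤ r) : ‖x‖ ≤ s := by
  refine abs_le_of_sq_le_sq' ?_ hs |>.2
  rw [EuclideanSpace.real_norm_sq_eq, Fin.sum_univ_two]
  have h := fun i => sq_le_sq' (abs_le.1 (hx i)).1 (abs_le.1 (hx i)).2
  linarith [h 0, h 1]

/-- A function which detects large values and is controlled by the potential. -/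
lemma exists_truncation (hV : IsMultiWell V) :
    ∃ R > (0 : ℝ), (∀ y, R < ‖y‖ → 0 < ⟪y, gradient V y⟫) ∧ ∃ Ψ : Evec k → ℝ,
      ContDiff ℝ (⊤ : ℕ∞) Ψ ∧ (∀ y, 0 ≤ Ψ y) ∧ (∀ y, R ^ 2 + 1 ≤ ‖y‖ ^ 2 → Ψ y = 1) ∧
      (∀ y, Ψ y ≤ V y) ∧ ∃ C > (0 : ℝ), ∀ y, ‖fderiv ℝ Ψ y‖ ^ 2 ≤ C * V y := by
  obtain ⟨α, hα, R₁, hR₁, hg⟩ := hV.growth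
  obtain ⟨R₂, hc⟩ := hV.coercive 1
  set R := max R₁ R₂ with hR
  have hR0 : 0 < R := hR₁.trans_le (le_max_left _ _)
  have hV1 : ∀ y, R ≤ ‖y‖ → 1 ≤ V y := fun y hy => hc y ((le_max_right _ _).trans hy)
  set Ψ : Evec k → ℝ := fun y => Real.smoothTransition (‖y‖ ^ 2 - R ^ 2) with hΨ
  have hΨs : ContDiff ℝ (⊤ : ℕ∞) Ψ :=
    Real.smoothTransition.contDiff.comp ((contDiff_norm_sq ℝ).sub contDiff_const)
  have hzero : ∀ y, ‖y‖ < R → Ψ y = 0 := fun y hy =>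
    Real.smoothTransition.zero_of_nonpos (by nlinarith [norm_nonneg y])
  obtain ⟨B, hB⟩ := (isCompact_closedBall (0 : Evec k) (R + 1)).bddAbove_image
    (contDiff_fderiv hΨs).continuous.norm.continuousOn
  have hB' : ∀ y, ‖fderiv ℝ Ψ y‖ ≤ |B| := by
    intro y
    by_cases hy : ‖y‖ ≤ R + 1
    · exact (hB ⟨y, by simpa using hy, rfl⟩).trans (le_abs_self _)
    · have h1 : Ψ =ᶠ[𝓝 y] fun _ => 1 := by
        filter_upwards [(isOpen_lt continuous_const continuous_norm).mem_nhds (not_le.1 hy)]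
          with z hz
        have hz' : R + 1 < ‖z‖ := hz
        exact Real.smoothTransition.one_of_one_le (by nlinarith)
      rw [h1.fderiv_eq]
      simp
  refine ⟨R, hR0, fun y hy => ?_, Ψ, hΨs, fun y => Real.smoothTransition.nonneg _,
    fun y hy => Real.smoothTransition.one_of_one_le (by linarith), fun y => ?_, B ^ 2 + 1,
    by positivity, fun y => ?_⟩
  · have h1 : 0 < ‖y‖ := hR0.trans hy
    exact lt_of_lt_of_le (by positivity) (hg y ((le_max_left _ _).trans_lt hy))
  · rcases lt_or_ge ‖y‖ R with h | h
    · rw [hzero y h]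
      exact hV.nonneg y
    · exact (Real.smoothTransition.le_one _).trans (hV1 y h)
  · rcases lt_or_ge ‖y‖ R with h | h
    · have h1 : Ψ =ᶠ[𝓝 y] fun _ => 0 := by
        filter_upwards [(isOpen_lt continuous_norm continuous_const).mem_nhds h] with z hz
        exact hzero z hz
      rw [h1.fderiv_eq]
      have := hV.nonneg y
      simp
      positivity
    · have h1 : ‖fderiv ℝ Ψ y‖ ^ 2 ≤ B ^ 2 := by
        rw [← sq_abs B]
        exact pow_le_pow_left₀ (norm_nonneg _) (hB' y) 2
      nlinarith [hV1 y h, sq_nonneg B]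

lemma exists_lt_one_of_integral_lt {f : ℝ → ℝ} (hf : Integrable f) (h0 : ∀ t, 0 ≤ f t) {a b : ℝ}
    (hab : a ≤ b) (h : ∫ t, f t < b - a) : ∃ t, a ≤ t ∧ t ≤ b ∧ f t < 1 := by
  by_contra! hc
  have h1 : ∫ _ in Set.Icc a b, (1 : ℝ) ≤ ∫ t in Set.Icc a b, f t :=
    setIntegral_mono_on (by simp) hf.integrableOn measurableSet_Icc fun t ht => hc t ht.1 ht.2
  have h2 := setIntegral_le_integral (s := Set.Icc a b) hf (Eventually.of_forall h0)
  simp [hab] at h1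
  linarith

lemma pd_pd_inner_const {u : E2 → Evec k} (hu : ContDiff ℝ (⊤ : ℕ∞) u) (ξ : Evec k) (x : E2) :
    ∑ i, pd i (pd i fun y => ⟪u y, ξ⟫) x = ⟪∑ i, pd i (pd i u) x, ξ⟫ := by
  have h1 : ∀ (f : E2 → Evec k), ContDiff ℝ (⊤ : ℕ∞) f → ∀ i,
      pd i (fun y => ⟪f y, ξ⟫) = fun y => ⟪pd i f y, ξ⟫ := fun f hf i => by
    funext y
    rw [pd_inner i (hf.differentiable (by simp) y) (differentiableAt_const ξ)]
    simp [pd]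
  rw [sum_inner]
  exact Finset.sum_congr rfl fun i _ => by rw [h1 u hu, h1 _ (contDiff_pd hu i)]

lemma two_inner_le_laplacian_norm_sq {u : E2 → Evec k} (hu : ContDiff ℝ (⊤ : ℕ∞) u) (x : E2) :
    2 * ⟪u x, ∑ i, pd i (pd i u) x⟫ ≤ ∑ i, pd i (pd i fun y => ⟪u y, u y⟫) x := by
  have hd := hu.differentiable (by simp)
  have h1 : ∀ i, pd i (fun y => ⟪u y, u y⟫) = fun y => 2 * ⟪u y, pd i u y⟫ := fun i => by
    funext y
    rw [pd_inner i (hd y) (hd y), real_inner_comm]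
    ring
  rw [inner_sum, Finset.mul_sum]
  refine Finset.sum_le_sum fun i _ => ?_
  have hd' := (contDiff_pd hu i).differentiable (by simp)
  rw [h1, pd_const_mul i 2 ((hd x).inner ℝ (hd' x)), pd_inner i (hd x) (hd' x)]
  have := real_inner_self_nonneg (x := pd i u x)
  linarith

lemma exists_norm_le_of_energy_lt (hV : IsMultiWell V) :
    ∃ η > (0 : ℝ), ∃ M > (0 : ℝ), ∀ (ε : ℝ) (u : E2 → Evec k), 0 < ε → ε ≤ 1 →
      ContDiff ℝ (⊤ : ℕ∞) u →
      (∀ x ∈ ball (0 : E2) (15 / 16), ∑ i, pd i (pd i u) x = (ε ^ 2)⁻¹ • gradient V (u x)) →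
      IntegrableOn (eDens V ε u) (ball 0 (15 / 16)) → energy V ε u (ball 0 (15 / 16)) < η →
      ∀ x ∈ ball (0 : E2) (3 / 5), ‖u x‖ ≤ M := by
  obtain ⟨R, hR, hgrad, Ψ, hΨ, hΨ0, hΨ1, hΨV, C, hC, hDΨ⟩ := exists_truncation hV
  obtain ⟨χ, hχ, hχc, hχs, hχ1, hχ0, hχle, L, hL0, hL⟩ := exists_cutoff
    (show (0 : ℝ) < 23 / 25 by norm_num) (show (23 / 25 : ℝ) < 15 / 16 by norm_num)
  set K := L * 1 + C / 2 + 1 with hK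
  have hK0 : 0 < K := by positivity
  refine ⟨1 / (20 * K), by positivity, R + 1, by positivity, ?_⟩
  intro ε u hε hε1 hu hpde he hE x hx
  set w : E2 → ℝ := fun y => χ y * Ψ (u y) with hw
  have hws : ContDiff ℝ 1 w := (hχ.mul (hΨ.comp hu)).of_le (by simp)
  have hwc : HasCompactSupport w := hχc.mul_right
  have hInt : ∀ i, ∫ t, lineVar i w t < 1 / 20 := fun i => by
    rw [integral_lineVar hws hwc]
    have h := integral_abs_pd_cutoff_le hV.nonneg hu hε he hΨ hΨ0 hC.le zero_le_one
      (fun x _ => by simpa using hΨV (u x)) (fun x _ => hDΨ (u x)) hε1 (hχ.of_le (by simp)) hχs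
      hχ0 hχle hL (1 - i)
    refine h.trans_lt ?_
    rw [lt_div_iff₀ (by positivity)] at hE
    change K * energy V ε u (ball 0 (15 / 16)) < 1 / 20
    linarith
  have hgood : ∀ a b : ℝ, b - a = 1 / 20 → ∀ i, ∃ t, a ≤ t ∧ t ≤ b ∧ lineVar i w t < 1 :=
    fun a b hab i => exists_lt_one_of_integral_lt (integrable_lineVar hws hwc i)
      (lineVar_nonneg i) (by linarith) (by rw [hab]; exact hInt i)
  choose r hr1 hr2 hr using hgood (3 / 5) (13 / 20) (by norm_num)
  choose l hl1 hl2 hl using hgood (-(13 / 20)) (-(3 / 5)) (by norm_num)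
  have hrect : ∀ y : E2, (∀ i, l i ≤ y i ∧ y i ≤ r i) → ‖y‖ ≤ 23 / 25 := fun y hy =>
    norm_le_of_abs_coord_le (r := 13 / 20) (by norm_num) (by norm_num) fun i =>
      abs_le.2 ⟨by linarith [(hy i).1, hl1 i], by linarith [(hy i).2, hr2 i]⟩
  have hu2 : ContDiff ℝ (⊤ : ℕ∞) fun y => ⟪u y, u y⟫ := hu.inner ℝ hu
  have hbound : ⟪u x, u x⟫ ≤ R ^ 2 + 1 := by
    refine le_of_laplacian_pos (g := fun y => ⟪u y, u y⟫) hu2 (l := l) (r := r) ?_ ?_ ?_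
    · intro y hy hyb
      have hw1 : w y < 1 := by
        obtain ⟨i, hi⟩ := hyb
        refine ((le_abs_self _).trans (abs_le_lineVar hws hwc i y)).trans_lt ?_
        rcases hi with hi | hi <;> rw [hi]
        exacts [hl i, hr i]
      by_contra! hc
      rw [real_inner_self_eq_norm_sq] at hc
      rw [hw] at hw1
      simp [hχ1 y (by simpa using hrect y hy), hΨ1 _ hc.le] at hw1
    · intro y hy hyR
      have hyb : y ∈ ball (0 : E2) (15 / 16) := by
        have := hrect y fun i => ⟨(hy i).1.le, (hy i).2.le⟩
        rw [mem_ball_zero_iff]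
        linarith
      rw [real_inner_self_eq_norm_sq] at hyR
      have hg := hgrad (u y) (by nlinarith [norm_nonneg (u y)])
      refine lt_of_lt_of_le ?_ (two_inner_le_laplacian_norm_sq hu y)
      rw [hpde y hyb, real_inner_smul_right]
      positivity
    · intro i
      have h1 : |x i| ≤ 3 / 5 :=
        (PiLp.norm_apply_le x i).trans (mem_ball_zero_iff.1 hx).le
      rw [abs_le] at h1
      exact ⟨by linarith [hl2 i], by linarith [hr1 i]⟩
  rw [real_inner_self_eq_norm_sq] at hbound
  nlinarith [norm_nonneg (u x)]

lemma exists_pd_le_of_norm_le (hV : IsMultiWell V) {M : ℝ} (hM : 0 < M) :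
    ∃ Cg > (0 : ℝ), ∀ (ε : ℝ) (u : E2 → Evec k), 0 < ε → ε ≤ 1 → ContDiff ℝ (⊤ : ℕ∞) u →
      (∀ x ∈ ball (0 : E2) (3 / 5), ∑ i, pd i (pd i u) x = (ε ^ 2)⁻¹ • gradient V (u x)) →
      (∀ x ∈ ball (0 : E2) (3 / 5), ‖u x‖ ≤ M) →
      ∀ x ∈ ball (0 : E2) (29 / 50), ∀ i, ‖pd i u x‖ ≤ Cg / ε := by
  obtain ⟨G, hG⟩ := (isCompact_closedBall (0 : Evec k) M).bddAbove_image
    (contDiff_fderiv hV.smooth).continuous.norm.continuousOn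
  have hG' : ∀ y, ‖y‖ ≤ M → ‖gradient V y‖ ≤ |G| := fun y hy => by
    rw [norm_gradient]
    exact (hG ⟨y, by simpa using hy, rfl⟩).trans (le_abs_self _)
  refine ⟨200 * M + (|G| + 1) / 200, by positivity, ?_⟩
  intro ε u hε hε1 hu hpde hbd x₀ hx₀ i
  set ξ := pd i u x₀ with hξ
  rcases (norm_nonneg ξ).eq_or_lt with h0 | hpos
  · rw [← h0]
    positivity
  have hnear : ∀ x : E2, (∀ i, |x i - x₀ i| ≤ ε / 100) → x ∈ ball (0 : E2) (3 / 5) := by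
    intro x hx
    have h1 : ‖x - x₀‖ ≤ ε / 50 :=
      norm_le_of_abs_coord_le (r := ε / 100) (by positivity) (by nlinarith [sq_nonneg ε]) hx
    have h2 := norm_add_le (x - x₀) x₀
    rw [sub_add_cancel] at h2
    rw [mem_ball_zero_iff] at hx₀ ⊢
    linarith
  have h := abs_pd_le_of_laplacian_bound (g := fun y => ⟪u y, ξ⟫) (hu.inner ℝ contDiff_const)
    (x₀ := x₀) (d := ε / 100) (M := M * ‖ξ‖) (N := (ε ^ 2)⁻¹ * (|G| + 1) * ‖ξ‖) (by positivity)
    (fun x hx => (abs_real_inner_le_norm _ _).trans (by gcongr; exact hbd x (hnear x hx)))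
    (fun x hx => ?_) i
  · have h1 : pd i (fun y => ⟪u y, ξ⟫) x₀ = ‖ξ‖ * ‖ξ‖ := by
      rw [pd_inner i (hu.differentiable (by simp) x₀) (differentiableAt_const ξ), ← hξ,
        real_inner_self_eq_norm_mul_norm]
      simp [pd]
    rw [h1, abs_of_nonneg (by positivity)] at h
    have h2 : 2 * (M * ‖ξ‖) / (ε / 100) + ε / 100 / 2 * ((ε ^ 2)⁻¹ * (|G| + 1) * ‖ξ‖) =
        (200 * M + (|G| + 1) / 200) / ε * ‖ξ‖ := by
      field_simp
      ring
    rw [h2] at h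
    exact le_of_mul_le_mul_right h hpos
  · rw [pd_pd_inner_const hu, hpde x (hnear x hx), real_inner_smul_left, abs_mul,
      abs_of_pos (by positivity : 0 < (ε ^ 2)⁻¹), mul_assoc]
    gcongr
    refine (abs_real_inner_le_norm _ _).trans_lt ?_
    gcongr
    exact (hG' _ (hbd x (hnear x hx))).trans_lt (lt_add_one _)

end SupBound

/-! ### Reduction to maps defined on the whole plane -/

section Globalize

variable {k : ℕ} {V : Evec k → ℝ}

lemma exists_global_extension {u : E2 → Evec k} {a b : ℝ} (ha : 0 < a) (hab : a < b)
    (hu : ContDiffOn ℝ (⊤ : ℕ∞) u (ball 0 b)) :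
    ∃ v : E2 → Evec k, ContDiff ℝ (⊤ : ℕ∞) v ∧ Set.EqOn u v (ball 0 a) := by
  obtain ⟨χ, hχ, -, hχs, hχ1, -⟩ := exists_cutoff ha hab
  refine ⟨fun x => χ x • u x, contDiff_iff_contDiffAt.2 fun x => ?_, fun x hx => ?_⟩
  · by_cases hx : x ∈ ball (0 : E2) b
    · exact hχ.contDiffAt.smul (hu.contDiffAt (isOpen_ball.mem_nhds hx))
    · have h : (fun x => χ x • u x) =ᶠ[𝓝 x] fun _ => 0 := by
        filter_upwards [notMem_tsupport_iff_eventuallyEq.1 fun h => hx (hχs h)] with y hy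
        simp [hy]
      exact contDiffAt_const.congr_of_eventuallyEq h
  · simp [hχ1 x (ball_subset_closedBall hx)]

lemma eqOn_pder {u v : E2 → Evec k} {s : Set E2} (hs : IsOpen s) (h : Set.EqOn u v s)
    (i : Fin 2) : Set.EqOn (pder u i) (pder v i) s := fun x hx => by
  simp only [pder, (h.eventuallyEq_of_mem (hs.mem_nhds hx)).fderiv_eq]

lemma eqOn_lap {u v : E2 → Evec k} {s : Set E2} (hs : IsOpen s) (h : Set.EqOn u v s) :
    Set.EqOn (lap u) (lap v) s := fun _ hx =>
  Finset.sum_congr rfl fun i _ => eqOn_pder hs (eqOn_pder hs h i) i hx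

lemma eqOn_eDens {u v : E2 → Evec k} {ε : ℝ} {s : Set E2} (hs : IsOpen s) (h : Set.EqOn u v s) :
    Set.EqOn (eDens V ε u) (eDens V ε v) s := fun x hx => by
  simp only [eDens, gradSq, h hx, eqOn_pder hs h _ hx]

end Globalize

/-- the energy-decay estimate. There is a constant
`C_dec > 0` depending only on `V` such that every solution on the unit disk
satisfies `E_ε(u_ε, D²(9/16)) ≤ C_dec·[E_ε(u_ε,D²)^{3/2} + ε·E_ε(u_ε,D²)]`. -/
theorem statement_5 (k : ℕ) (hk : 1 ≤ k) (V : Evec k → ℝ) (hV : IsMultiWell V) :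
    ∃ Cdec > (0 : ℝ),
      ∀ ε : ℝ, 0 < ε → ε ≤ 1 →
      ∀ u : E2 → Evec k, IsSolution V ε (ball (0 : E2) 1) u →
        IntegrableOn (eDens V ε u) (ball (0 : E2) 1) →
        energy V ε u (ball (0 : E2) (9 / 16)) ≤
          Cdec * ((energy V ε u (ball (0 : E2) 1)) ^ ((3 : ℝ) / 2) +
            ε * energy V ε u (ball (0 : E2) 1)) := by
  obtain ⟨η, hη, M, hM, hsup⟩ := exists_norm_le_of_energy_lt hV
  obtain ⟨Cg, hCg, hgrad⟩ := exists_pd_le_of_norm_le hV hM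
  obtain ⟨C, hC, hdecay⟩ := exists_decay_of_isBoundedSolution hV M Cg
    (show (0 : ℝ) < 9 / 16 by norm_num) (show (9 / 16 : ℝ) < 29 / 50 by norm_num)
  set δ := min η 1 with hδ
  have hδ0 : 0 < δ := lt_min hη one_pos
  refine ⟨C + δ ^ (-(1 / 2) : ℝ), by positivity, fun ε hε hε1 u hu hInt => ?_⟩
  have hmono := fun {r : ℝ} (hr : r ≤ 1) =>
    energy_mono hV.nonneg hε hInt (ball_subset_ball (x := (0 : E2)) hr)
  have hE0 := energy_nonneg hV.nonneg hε u (ball 0 1)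
  rcases le_or_gt δ (energy V ε u (ball 0 1)) with hE | hE
  · refine (hmono (show (9 / 16 : ℝ) ≤ 1 by norm_num)).trans ?_
    set E := energy V ε u (ball 0 1)
    have hEpos : 0 < E := hδ0.trans_le hE
    have h1 : 1 ≤ δ ^ (-(1 / 2) : ℝ) * E ^ (1 / 2 : ℝ) := by
      rw [Real.rpow_neg hδ0.le, inv_mul_eq_div, one_le_div (by positivity)]
      gcongr
    have h2 : E ^ (3 / 2 : ℝ) = E * E ^ (1 / 2 : ℝ) := by
      rw [show (3 / 2 : ℝ) = 1 + 1 / 2 by norm_num, Real.rpow_add hEpos, Real.rpow_one]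
    calc E ≤ δ ^ (-(1 / 2) : ℝ) * E ^ (1 / 2 : ℝ) * E := le_mul_of_one_le_left hE0 h1
      _ = δ ^ (-(1 / 2) : ℝ) * E ^ (3 / 2 : ℝ) := by rw [h2]; ring
      _ ≤ (C + δ ^ (-(1 / 2) : ℝ)) * (E ^ (3 / 2 : ℝ) + ε * E) := by
        gcongr
        · linarith
        · have : 0 ≤ ε * E := by positivity
          linarith
  · obtain ⟨v, hv, huv⟩ := exists_global_extension (show (0 : ℝ) < 15 / 16 by norm_num)
      (show (15 / 16 : ℝ) < 1 by norm_num) hu.1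
    have hdens : Set.EqOn (eDens V ε u) (eDens V ε v) (ball 0 (15 / 16)) :=
      eqOn_eDens isOpen_ball huv
    have henergy : ∀ {r : ℝ}, r ≤ 15 / 16 → energy V ε v (ball 0 r) = energy V ε u (ball 0 r) :=
      fun hr => setIntegral_congr_fun measurableSet_ball
        fun x hx => (hdens (ball_subset_ball hr hx)).symm
    have hvint : IntegrableOn (eDens V ε v) (ball 0 (15 / 16)) :=
      (hInt.mono_set (ball_subset_ball (by norm_num))).congr_fun hdens measurableSet_ball
    have hpde : ∀ x ∈ ball (0 : E2) (15 / 16),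
        ∑ i, pd i (pd i v) x = (ε ^ 2)⁻¹ • gradient V (v x) := fun x hx => by
      rw [← huv hx, ← hu.2 x (ball_subset_ball (by norm_num) hx), eqOn_lap isOpen_ball huv hx]
      rfl
    have hnorm := hsup ε v hε hε1 hv hpde hvint <| by
      rw [henergy le_rfl]
      exact (hmono (by norm_num)).trans_lt (hE.trans_le (min_le_left _ _))
    have hpd := hgrad ε v hε hε1 hv
      (fun x hx => hpde x (ball_subset_ball (by norm_num) hx)) hnorm
    have hsol : IsBoundedSolution V M Cg ε (29 / 50) v :=
      ⟨hε, hε1, hv, fun x hx => hpde x (ball_subset_ball (by norm_num) hx),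
        hvint.mono_set (ball_subset_ball (by norm_num)),
        fun x hx => hnorm x (ball_subset_ball (by norm_num) hx), hpd⟩
    have hb : energy V ε u (ball 0 (29 / 50)) ≤ energy V ε u (ball 0 1) := hmono (by norm_num)
    have h := hdecay ε v hsol <| by
      rw [henergy (by norm_num)]
      exact hb.trans (hE.le.trans (min_le_right _ _))
    rw [henergy (by norm_num), henergy (by norm_num)] at h
    have hb0 := energy_nonneg hV.nonneg hε u (ball 0 (29 / 50))
    refine h.trans ?_
    gcongr
    exact le_add_of_nonneg_right (by positivity)
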